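/- arXiv:2107.02116 — 4 statements merged into one kernel-verified Lean document; each statement's English description precedes it below -/
import Mathlib

section
/- The probability measure μ(k) = 2·k^(k-2)/(e^k·k!) on positive integers has mean 2, i.e. Σ_{k≥1} k · 2·k^(k-2)/(e^k·k!) = 2. -/
noncomputable def treeC (k : ℕ) : ℝ := (k : ℝ) ^ k / (k * (Nat.factorial k : ℝ))

lemma treeC_nonneg (k : ℕ) : 0 ≤ treeC k := by unfold treeC; positivity

lemma treeC_le (k : ℕ) : treeC k ≤ Real.exp 1 ^ k := by
  unfold treeC
  rcases Nat.eq_zero_or_pos k with rfl | hk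
  · simp
  · have h := Real.pow_div_factorial_le_exp (x := (k : ℝ)) (by positivity) k
    rw [← Real.exp_nat_mul, mul_one]
    refine le_trans ?_ h
    have hk' : (1 : ℝ) ≤ k := by exact_mod_cast hk
    apply div_le_div_of_nonneg_left (by positivity) (by positivity)
    have : (0 : ℝ) < (Nat.factorial k : ℝ) := by positivity
    nlinarith

lemma treeC_summable (s : ℝ) (hs : Real.exp 1 * |s| < 1) :
    Summable (fun k => treeC k * |s| ^ k) := by
  refine Summable.of_nonneg_of_le (fun k => mul_nonneg (treeC_nonneg k) (by positivity))
    (fun k => ?_) (summable_geometric_of_lt_one (r := Real.exp 1 * |s|) (by positivity) hs)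
  rw [mul_pow]
  exact mul_le_mul_of_nonneg_right (treeC_le k) (by positivity)

lemma treeC_analytic (s : ℝ) (hs : Real.exp 1 * |s| < 1) :
    AnalyticAt ℝ (fun s : ℝ => ∑' k, treeC k * s ^ k) s := by
  set p := FormalMultilinearSeries.ofScalars ℝ treeC with hp
  have hr : ((Real.toNNReal (Real.exp (-1)) : NNReal) : ENNReal) ≤ p.radius := by
    apply p.le_radius_of_bound 1
    intro n
    rw [hp, FormalMultilinearSeries.ofScalars_norm, Real.coe_toNNReal _ (Real.exp_pos _).le,
      Real.norm_of_nonneg (treeC_nonneg n)]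
    calc treeC n * Real.exp (-1) ^ n ≤ Real.exp 1 ^ n * Real.exp (-1) ^ n :=
          mul_le_mul_of_nonneg_right (treeC_le n) (by positivity)
      _ = 1 := by rw [← mul_pow, ← Real.exp_add]; simp
  have hpos : 0 < p.radius := lt_of_lt_of_le (by simp [Real.exp_pos]) hr
  have hb := p.hasFPowerSeriesOnBall hpos
  have heq : p.sum = (fun s : ℝ => ∑' k, treeC k * s ^ k) := by
    funext s
    have := FormalMultilinearSeries.ofScalars_sum_eq (E := ℝ) treeC s
    simpa [FormalMultilinearSeries.ofScalarsSum] using this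
  rw [← heq]
  apply hb.analyticAt_of_mem
  rw [Metric.mem_eball, edist_zero_right]
  refine lt_of_lt_of_le ?_ hr
  rw [← ofReal_norm, ENNReal.ofReal]
  rw [ENNReal.coe_lt_coe, Real.toNNReal_lt_toNNReal_iff (Real.exp_pos _), Real.norm_eq_abs,
    Real.exp_neg, ← one_div, lt_div_iff₀ (Real.exp_pos 1)]
  linarith

lemma tree_coeff (n : ℕ) (x : ℝ) :
    ∑ p ∈ Finset.HasAntidiagonal.antidiagonal n,
      treeC p.1 * x ^ p.1 * ((-(p.1 * x)) ^ p.2 / (Nat.factorial p.2 : ℝ)) =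
      if n = 1 then x else 0 := by
  rcases n with _ | _ | n
  · simp [treeC]
  · simp [treeC, Finset.Nat.antidiagonal_succ]
  · have h := congrFun (Polynomial.fwdDiff_iter_eq_zero_of_degree_lt (R := ℝ)
      (P := Polynomial.X ^ (n + 1)) (n := n + 2) (by simp)) 0
    rw [fwdDiff_iter_eq_sum_shift] at h
    rw [Finset.Nat.sum_antidiagonal_eq_sum_range_succ_mk, if_neg (by omega)]
    have : ∑ k ∈ Finset.range (n + 2 + 1), treeC k * x ^ k *
        ((-(k * x)) ^ (n + 2 - k) / (Nat.factorial (n + 2 - k) : ℝ)) =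
        x ^ (n + 2) / (Nat.factorial (n + 2)) * ∑ k ∈ Finset.range (n + 2 + 1),
          ((-1 : ℤ) ^ (n + 2 - k) * (n + 2).choose k) •
            Polynomial.eval ((0 : ℝ) + k • (1 : ℝ)) (Polynomial.X ^ (n + 1)) := by
      rw [Finset.mul_sum]
      refine Finset.sum_congr rfl fun k hk => ?_
      have hk' : k ≤ n + 2 := by simpa [Nat.lt_succ_iff] using hk
      obtain ⟨j, hj⟩ := Nat.exists_eq_add_of_le hk'
      have hj' : n + 2 - k = j := by omega
      rw [hj', hj, Nat.choose_symm_add]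
      have hch : (((k + j).choose j : ℕ) : ℝ) * (k.factorial : ℝ) * (j.factorial : ℝ) =
          ((k + j).factorial : ℝ) := by
        exact_mod_cast Nat.add_choose_mul_factorial_mul_factorial k j
      rcases Nat.eq_zero_or_pos k with rfl | hkp
      · simp [treeC]
      · have hk0 : (k : ℝ) ≠ 0 := by positivity
        have hpw : (k : ℝ) ^ k * (k : ℝ) ^ j = k * (k : ℝ) ^ (n + 1) := by
          rw [← pow_add, ← hj]; ring
        rw [zsmul_eq_mul]
        push_cast
        simp only [treeC, Polynomial.eval_pow, Polynomial.eval_X, zero_add, nsmul_eq_mul, mul_one]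
        rw [neg_pow, mul_pow, pow_add, ← hch]
        have hc0 : (((k + j).choose j : ℕ) : ℝ) ≠ 0 := by
          exact_mod_cast (Nat.choose_pos (Nat.le_add_left j k)).ne'
        field_simp
        linear_combination x ^ k * x ^ j * hpw
    rw [this, h]; simp

lemma tree_small (x : ℝ) (hx : Real.exp 1 * |(|x| * Real.exp |x|)| < 1) :
    ∑' k, treeC k * (x * Real.exp (-x)) ^ k = x := by
  set F : ℕ × ℕ → ℝ := fun p =>
    treeC p.1 * x ^ p.1 * ((-(p.1 * x)) ^ p.2 / (Nat.factorial p.2 : ℝ)) with hF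
  have hexp : ∀ y : ℝ, HasSum (fun j : ℕ => y ^ j / (Nat.factorial j : ℝ)) (Real.exp y) := by
    intro y
    rw [Real.exp_eq_exp_ℝ]
    exact NormedSpace.expSeries_div_hasSum_exp y
  have hn : ∀ k j, ‖F (k, j)‖ = treeC k * |x| ^ k * ((k * |x|) ^ j / (Nat.factorial j : ℝ)) := by
    intro k j
    simp [hF, abs_mul, abs_div, abs_of_nonneg (treeC_nonneg k)]
  have hsum : Summable F := by
    apply Summable.of_norm
    rw [summable_prod_of_nonneg (fun _ => norm_nonneg _)]
    simp only [hn]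
    refine ⟨fun k => ((hexp _).summable).mul_left _, ?_⟩
    have := treeC_summable _ hx
    refine this.congr fun k => ?_
    rw [tsum_mul_left, (hexp _).tsum_eq, abs_of_nonneg (by positivity), mul_pow,
      ← Real.exp_nat_mul, mul_assoc]
  have h1 : ∑' p, F p = ∑' k, treeC k * (x * Real.exp (-x)) ^ k := by
    rw [hsum.tsum_prod]
    refine tsum_congr fun k => ?_
    simp only [hF]
    rw [tsum_mul_left, (hexp _).tsum_eq, mul_pow, ← Real.exp_nat_mul, mul_assoc, mul_neg]
  rw [← h1, ← Finset.HasAntidiagonal.sigmaAntidiagonalEquivProd.tsum_eq F]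
  have hs2 := (Finset.HasAntidiagonal.sigmaAntidiagonalEquivProd (A := ℕ)).summable_iff.mpr hsum
  refine (Summable.tsum_sigma' (fun n => (hasSum_fintype _).summable) hs2).trans ?_
  have : ∀ n : ℕ, ∑' c : Finset.HasAntidiagonal.antidiagonal n,
      F (Finset.HasAntidiagonal.sigmaAntidiagonalEquivProd ⟨n, c⟩) = if n = 1 then x else 0 := by
    intro n
    rw [← tree_coeff n x, tsum_fintype, ← Finset.sum_coe_sort (Finset.HasAntidiagonal.antidiagonal n)]
    rfl
  simp only [Function.comp_def, this]
  exact tsum_ite_eq 1 _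

lemma tree_bound (x : ℝ) (hx : |x| < 1 / 10) : Real.exp 1 * |(|x| * Real.exp |x|)| < 1 := by
  rw [abs_of_nonneg (by positivity)]
  have h1 : Real.exp |x| ≤ Real.exp 1 := Real.exp_le_exp.mpr (by linarith)
  have h2 := Real.exp_one_lt_d9
  have h3 := Real.exp_pos 1
  have h4 := abs_nonneg x
  calc Real.exp 1 * (|x| * Real.exp |x|) ≤ 2.8 * (1 / 10 * 2.8) := by
        gcongr <;> linarith
    _ < 1 := by norm_num

lemma tree_dom (x : ℝ) (hx : x ∈ Set.Ioo (-(1 / 10) : ℝ) 1) :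
    Real.exp 1 * |x * Real.exp (-x)| < 1 := by
  rcases le_or_gt 0 x with h0 | h0
  · rw [abs_of_nonneg (by positivity)]
    have h := Real.add_one_lt_exp (x := x - 1) (by linarith [hx.2])
    have h2 : Real.exp 1 * (x * Real.exp (-x)) = x * Real.exp (-(x - 1)) := by
      rw [show -(x - 1) = 1 + -x by ring, Real.exp_add]; ring
    rw [h2, Real.exp_neg, ← div_eq_mul_inv, div_lt_one (Real.exp_pos _)]
    linarith
  · have := tree_bound x (by rw [abs_of_neg h0]; linarith [hx.1])
    rw [abs_mul, abs_abs] at this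
    rw [abs_mul]
    rwa [show Real.exp |x| = Real.exp (-x) by rw [abs_of_neg h0]] at this

lemma tree_eq (x : ℝ) (hx : x ∈ Set.Ioo (-(1 / 10) : ℝ) 1) :
    ∑' k, treeC k * (x * Real.exp (-x)) ^ k = x := by
  have hf : AnalyticOnNhd ℝ (fun x : ℝ => ∑' k, treeC k * (x * Real.exp (-x)) ^ k)
      (Set.Ioo (-(1 / 10) : ℝ) 1) := by
    intro y hy
    have h1 : AnalyticAt ℝ (fun x : ℝ => x * Real.exp (-x)) y := by fun_prop
    exact AnalyticAt.fun_comp (g := fun s : ℝ => ∑' k, treeC k * s ^ k)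
      (f := fun x : ℝ => x * Real.exp (-x)) (treeC_analytic _ (tree_dom y hy)) h1
  have hg : AnalyticOnNhd ℝ (fun x : ℝ => x) (Set.Ioo (-(1 / 10) : ℝ) 1) := analyticOnNhd_id
  refine hf.eqOn_of_preconnected_of_eventuallyEq hg isPreconnected_Ioo (z₀ := 0)
    (by norm_num) ?_ hx
  filter_upwards [Ioo_mem_nhds (a := -(1 / 10 : ℝ)) (b := 1 / 10) (x := 0) (by norm_num)
    (by norm_num)] with y hy
  exact tree_small y (tree_bound y (abs_lt.mpr hy))

lemma tree_one : ∑' k, treeC k * (Real.exp (-1)) ^ k = 1 := by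
  have hle : ∀ n, ∑ k ∈ Finset.range n, treeC k * (Real.exp (-1)) ^ k ≤ 1 := by
    intro n
    have hc : Continuous (fun x : ℝ =>
      ∑ k ∈ Finset.range n, treeC k * (x * Real.exp (-x)) ^ k) := by fun_prop
    have ht := (hc.tendsto 1).mono_left (nhdsWithin_le_nhds (s := Set.Iio 1))
    simp only [one_mul] at ht
    refine le_of_tendsto ht ?_
    filter_upwards [Ioo_mem_nhdsLT (a := (0 : ℝ)) (b := 1) (by norm_num)] with x hx
    have hx' : x ∈ Set.Ioo (-(1 / 10) : ℝ) 1 := ⟨by linarith [hx.1], hx.2⟩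
    have hs := treeC_summable _ (tree_dom x hx')
    have h0 : 0 ≤ x * Real.exp (-x) := mul_nonneg hx.1.le (Real.exp_pos _).le
    rw [abs_of_nonneg h0] at hs
    have := hs.sum_le_tsum (Finset.range n)
      (fun k _ => mul_nonneg (treeC_nonneg k) (pow_nonneg h0 k))
    rw [tree_eq x hx'] at this
    linarith [hx.2]
  have hnn : ∀ k, 0 ≤ treeC k * (Real.exp (-1)) ^ k :=
    fun k => mul_nonneg (treeC_nonneg k) (by positivity)
  have hS := summable_of_sum_range_le hnn hle
  apply le_antisymm (Real.tsum_le_of_sum_range_le hnn hle)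
  apply le_of_forall_lt_imp_le_of_dense
  intro a ha
  have hx' : max a 0 ∈ Set.Ioo (-(1 / 10) : ℝ) 1 :=
    ⟨by linarith [le_max_right a 0], max_lt ha one_pos⟩
  refine le_trans (le_max_left a 0) ?_
  set x := max a 0 with hxdef
  have h0 : 0 ≤ x * Real.exp (-x) := mul_nonneg (le_max_right a 0) (Real.exp_pos _).le
  have hd := tree_dom x hx'
  have hs := treeC_summable _ hd
  rw [abs_of_nonneg h0] at hs hd
  rw [← tree_eq x hx']
  refine hs.tsum_le_tsum (fun k => ?_) hS
  refine mul_le_mul_of_nonneg_left (pow_le_pow_left₀ h0 ?_ k) (treeC_nonneg k)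
  rw [Real.exp_neg 1, ← one_div, le_div_iff₀ (Real.exp_pos 1)]
  linarith

/-- The probability measure `μ(k) = 2·k^(k-2)/(e^k·k!)` on `{1,2,…}` has mean `2`:
`Σ_{k≥1} k · 2 k^(k-2) e^(-k)/k! = 2`. -/
theorem stmt6 :
    ∑' k : ℕ+, ((k : ℕ) : ℝ) * (2 * ((k : ℕ) : ℝ) ^ ((k : ℕ) - 2) /
        (Real.exp 1 ^ (k : ℕ) * (Nat.factorial (k : ℕ) : ℝ))) = 2 := by
  have h : ∀ k : ℕ+, ((k : ℕ) : ℝ) * (2 * ((k : ℕ) : ℝ) ^ ((k : ℕ) - 2) /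
        (Real.exp 1 ^ (k : ℕ) * (Nat.factorial (k : ℕ) : ℝ))) =
      2 * (treeC k * (Real.exp (-1)) ^ (k : ℕ)) := by
    intro k
    obtain ⟨n, hn⟩ : ∃ n : ℕ, (k : ℕ) = n + 1 := ⟨k - 1, by have := k.pos; omega⟩
    rw [hn, Real.exp_neg, inv_pow, treeC]
    rcases n with _ | n
    · simp; ring
    · rw [show n + 1 + 1 - 2 = n by omega]
      have : ((n + 1 + 1 : ℕ) : ℝ) ≠ 0 := by positivity
      field_simp
      ring
  rw [tsum_congr h, tsum_mul_left,
    tsum_pnat_eq_tsum_of_eq_zero (f := fun k => treeC k * (Real.exp (-1)) ^ k) (by simp [treeC]),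
    tree_one, mul_one]
end

section
/- For n ≥ 1 and 0 ≤ m ≤ n, the probability that m i.i.d. uniform cars all manage to park on a uniform rooted Cayley tree T_n, multiplied by (1 - m/n), equals the probability that the multigraph G(n,m) is acyclic; equivalently, PF_root(n,m) = n^{n-m-1} · m! · 2^m · #F(n,m), where #F(n,m) is the number of unrooted forests on {1,...,n} with m edges. -/
/-- One driving step following parent pointers. -/
def pstep {n : ℕ} (p : Fin n → Option (Fin n)) (o : Option (Fin n)) : Option (Fin n) :=
  o.bind p

/-- `p` is (the parent function of) a forest of rooted trees on `{1,…,n}`: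
every ancestor chain terminates (no cycles). -/
def IsRootedForest {n : ℕ} (p : Fin n → Option (Fin n)) : Prop :=
  ∀ v : Fin n, (pstep p)^[n] (some v) = none

/-- `p` is (the parent function of) a rooted Cayley tree on `{1,…,n}`. -/
def IsRootedTree {n : ℕ} (p : Fin n → Option (Fin n)) : Prop :=
  IsRootedForest p ∧ ∃! r : Fin n, p r = none

/-- A car arriving at `v` with current occupation `occ` drives towards the root and
parks at the first empty vertex on its way (`none` if it exits through the root).
`fuel` bounds the number of steps; `fuel = n` suffices on a tree with `n` vertices. -/
def drive {n : ℕ} (p : Fin n → Option (Fin n)) (occ : Finset (Fin n)) :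
    ℕ → Fin n → Option (Fin n)
  | 0, _ => none
  | fuel + 1, v => if v ∈ occ then (p v).bind (drive p occ fuel) else some v

/-- Sequentially park the cars of the list `xs`; returns the final occupied set if
every car managed to park, and `none` otherwise. -/
def parkAll {n : ℕ} (p : Fin n → Option (Fin n)) :
    Finset (Fin n) → List (Fin n) → Option (Finset (Fin n))
  | occ, [] => some occ
  | occ, v :: rest =>
      match drive p occ n v with
      | none => none
      | some s => parkAll p (insert s occ) rest

/-- `PF n m`: number of pairs (rooted Cayley tree on `{1,…,n}`, sequence of `m` car
arrivals) such that all `m` cars manage to park. -/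
noncomputable def PF (n m : ℕ) : ℕ :=
  Nat.card {q : (Fin n → Option (Fin n)) × (Fin m → Fin n) //
    IsRootedTree q.1 ∧ (parkAll q.1 ∅ (List.ofFn q.2)).isSome}

/-- `PFroot n m`: number of pairs (rooted Cayley tree on `{1,…,n}`, sequence of `m`
car arrivals) such that all `m` cars park and the root vertex stays empty. -/
noncomputable def PFroot (n m : ℕ) : ℕ :=
  Nat.card {q : (Fin n → Option (Fin n)) × (Fin m → Fin n) //
    IsRootedTree q.1 ∧ ∃ occ : Finset (Fin n),
      parkAll q.1 ∅ (List.ofFn q.2) = some occ ∧ ∀ r, q.1 r = none → r ∉ occ}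

/-- Number of unrooted forests on `{1,…,n}` with `m` edges. -/
noncomputable def forestCount (n m : ℕ) : ℕ :=
  Nat.card {G : SimpleGraph (Fin n) // G.IsAcyclic ∧ Nat.card G.edgeSet = m}

open Finset

namespace Pk

variable {V : Type*}

/-- `RootOf q v r`: following `q` from `v` ends at `r`. -/
inductive RootOf (q : V → Option V) : V → V → Prop
  | base {v} : q v = none → RootOf q v v
  | step {v w r} : q v = some w → RootOf q w r → RootOf q v r

inductive Drv (q : V → Option V) (O : Finset V) : V → V → Prop
  | base {v} : v ∉ O → Drv q O v v
  | step {v w r} : v ∈ O → q v = some w → Drv q O w r → Drv q O v r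

def Sub (q p : V → Option V) : Prop := ∀ v w, q v = some w → p v = some w

def Forest (q : V → Option V) : Prop := ∀ v, ∃ r, RootOf q v r

theorem RootOf.none {q : V → Option V} {v r : V} (h : RootOf q v r) : q r = none := by
  induction h with
  | base h => exact h
  | step _ _ ih => exact ih

theorem RootOf.uniq {q : V → Option V} {v r s : V} (h : RootOf q v r) (h' : RootOf q v s) :
    r = s := by
  induction h with
  | base h => cases h' with
    | base _ => rfl
    | step h1 _ => simp [h] at h1
  | step h1 _ ih => cases h' with
    | base h2 => simp [h1] at h2
    | step h2 h3 =>
      rw [h1] at h2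
      cases h2
      exact ih h3

theorem RootOf.next {q : V → Option V} {v w r : V} (h : RootOf q v r) (hw : q v = some w) :
    RootOf q w r := by
  cases h with
  | base h => simp [hw] at h
  | step h1 h2 => rw [hw] at h1; cases h1; exact h2

/-- no cycles -/
theorem RootOf.acyc_aux {q : V → Option V} {v r : V} (h : RootOf q v r) : q v ≠ some v := by
  induction h with
  | base h => simp [h]
  | @step v w r h1 h2 ih =>
    intro h3
    rw [h1] at h3; cases h3
    exact ih h1

theorem Drv.uniq {q : V → Option V} {O : Finset V} {v r s : V} (h : Drv q O v r)
    (h' : Drv q O v s) : r = s := by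
  induction h with
  | base h => cases h' with
    | base _ => rfl
    | step h1 _ => exact absurd h1 h
  | step h0 h1 _ ih => cases h' with
    | base h2 => exact absurd h0 h2
    | step _ h2 h3 =>
      rw [h1] at h2
      cases h2
      exact ih h3

theorem Drv.notMem {q : V → Option V} {O : Finset V} {v r : V} (h : Drv q O v r) : r ∉ O := by
  induction h with
  | base h => exact h
  | step _ _ _ ih => exact ih

theorem Drv.mono {q p : V → Option V} (hqp : Sub q p) {O : Finset V} {v r : V}
    (h : Drv q O v r) : Drv p O v r := by
  induction h with
  | base h => exact .base h
  | step h0 h1 _ ih => exact .step h0 (hqp _ _ h1) ih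

theorem Sub.forest {q p : V → Option V} (hqp : Sub q p) (hp : Forest p) : Forest q := by
  intro v
  obtain ⟨r, hr⟩ := hp v
  induction hr with
  | @base v h =>
    refine ⟨v, .base ?_⟩
    cases h' : q v with
    | none => rfl
    | some w => simp [hqp _ _ h'] at h
  | @step v w r h1 h2 ih =>
    cases h' : q v with
    | none => exact ⟨v, .base h'⟩
    | some w' =>
      have := hqp _ _ h'
      rw [h1] at this; cases this
      obtain ⟨r, hr⟩ := ih
      exact ⟨r, .step h' hr⟩

theorem Sub.rootOf {q p : V → Option V} (hqp : Sub q p) {v r t : V} (h : RootOf q v r)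
    (ht : RootOf p v t) : RootOf p r t := by
  induction h with
  | base h => exact ht
  | step h1 h2 ih => exact ih (ht.next (hqp _ _ h1))

section upd
variable [DecidableEq V]

theorem sub_update {q : V → Option V} {s : V} (hs : q s = none) (o : Option V) :
    Sub q (Function.update q s o) := by
  intro v w h
  rw [Function.update_of_ne]; exact h
  rintro rfl; simp [hs] at h

theorem update_sub {q : V → Option V} {s : V} :
    Sub (Function.update q s none) q := by
  intro v w h
  by_cases hv : v = s
  · subst hv; simp at h
  · rwa [Function.update_of_ne hv] at h

theorem rootOf_update_ne {q : V → Option V} {s : V} (o : Option V)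
    {v r : V} (h : RootOf q v r) (hr : r ≠ s) (hs : q s = none) :
    RootOf (Function.update q s o) v r := by
  induction h with
  | base h => exact .base (by rwa [Function.update_of_ne hr])
  | @step v w r h1 h2 ih =>
    exact .step (sub_update hs o _ _ h1) (ih hr)

theorem rootOf_update_eq {q : V → Option V} {s b t : V} 
    {v : V} (h : RootOf q v s) (hb : RootOf q b t) (hts : t ≠ s) :
    RootOf (Function.update q s (some b)) v t := by
  have hs := h.none
  have hb' := rootOf_update_ne (some b) hb hts hs
  have key : RootOf (Function.update q s (some b)) s t := .step (by simp) hb'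
  clear hb hb'
  induction h with
  | base h => exact key
  | step h1 h2 ih => exact .step (sub_update hs _ _ _ h1) (ih hts hs key)

theorem forest_update {q : V → Option V} (hq : Forest q) {s b : V} (hs : q s = none)
    (hb : ¬ RootOf q b s) : Forest (Function.update q s (some b)) := by
  obtain ⟨t, ht⟩ := hq b
  have hts : t ≠ s := by rintro rfl; exact hb ht
  intro v
  obtain ⟨r, hr⟩ := hq v
  by_cases h : r = s
  · subst h; exact ⟨t, rootOf_update_eq hr ht hts⟩
  · exact ⟨r, rootOf_update_ne _ hr h hs⟩

theorem rootOf_update_iff {q : V → Option V} (hq : Forest q) {s b t : V} (hs : q s = none)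
    (hb : RootOf q b t) (hts : t ≠ s) (v r : V) :
    RootOf (Function.update q s (some b)) v r ↔
      (RootOf q v r ∧ r ≠ s) ∨ (RootOf q v s ∧ r = t) := by
  obtain ⟨r', hr'⟩ := hq v
  by_cases h : r' = s
  · subst h
    constructor
    · intro h1
      right
      exact ⟨hr', h1.uniq (rootOf_update_eq hr' hb hts)⟩
    · rintro (⟨h1, h2⟩ | ⟨h1, rfl⟩)
      · exact absurd (h1.uniq hr') h2
      · exact rootOf_update_eq hr' hb hts
  · constructor
    · intro h1
      left
      have := h1.uniq (rootOf_update_ne _ hr' h hs)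
      subst this
      exact ⟨hr', h⟩
    · rintro (⟨h1, h2⟩ | ⟨h1, rfl⟩)
      · exact rootOf_update_ne _ h1 h2 hs
      · exact absurd (hr'.uniq h1) h

/-- a cycle prevents being a forest -/
theorem not_forest_update {p : V → Option V} {q : V → Option V} (hqp : Sub q p) (hp : Forest p)
    {s b : V} (h : p s = some b) (hb : RootOf q b s) : False := by
  -- strong statement: depth
  obtain ⟨r, hr⟩ := hp s
  have key : ∀ u r, RootOf p u r → RootOf q u s → False := by
    intro u r hu
    induction hu with
    | base h1 =>
      intro h2
      cases h2 with
      | base h3 => simp [h] at h1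
      | step h3 h4 => simp [hqp _ _ h3] at h1
    | @step u w r h1 h2 ih =>
      intro h3
      cases h3 with
      | base h4 => rw [h] at h1; cases h1; exact ih hb
      | step h4 h5 => rw [hqp _ _ h4] at h1; cases h1; exact ih h5
  exact key b r (hr.next h) hb

end upd

section completions
variable [DecidableEq V] [Fintype V]
open Classical in
noncomputable def Cr (q : V → Option V) (r : V) : Finset (V → Option V) :=
  {p | Sub q p ∧ ∀ v, RootOf p v r}
open Classical in
noncomputable def cmp (q : V → Option V) (r : V) : Finset V := {v | RootOf q v r}

def rts (q : V → Option V) : Finset V := {v | q v = none}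

theorem card_Cr (k : ℕ) : ∀ (q : V → Option V), Forest q → #(rts q) = k + 1 → ∀ r, 
    Fintype.card V * #(Cr q r) = #(cmp q r) * Fintype.card V ^ k := by
  induction k with
  | zero =>
    intro q hq hk r
    rw [zero_add, card_eq_one] at hk
    obtain ⟨s, hs⟩ := hk
    have hs' : ∀ v, q v = none ↔ v = s := by
      intro v
      have := congrArg (v ∈ ·) hs
      simpa [rts] using this
    have hall : ∀ v, RootOf q v s := by
      intro v
      obtain ⟨t, ht⟩ := hq v
      have := (hs' t).1 ht.none
      rwa [this] at ht
    by_cases hr : r = s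
    · subst hr
      have h1 : cmp q r = univ := by ext v; simp [cmp, hall]
      have h2 : Cr q r = {q} := by
        ext p
        simp only [Cr, mem_filter, mem_univ, true_and, mem_singleton]
        constructor
        · rintro ⟨h, h'⟩
          ext1 v
          cases hv : q v with
          | none => 
            rw [hs'] at hv
            subst hv
            exact (h' v).none
          | some w => exact h _ _ hv
        · rintro rfl
          exact ⟨fun _ _ h => h, hall⟩
      simp [h1, h2]
    · have h1 : cmp q r = ∅ := by
        ext v; simp only [cmp, mem_filter, mem_univ, true_and, notMem_empty, iff_false]
        intro h
        exact hr (h.uniq (hall v))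
      have h2 : Cr q r = ∅ := by
        ext p
        simp only [Cr, mem_filter, mem_univ, true_and, notMem_empty, iff_false]
        rintro ⟨h, h'⟩
        cases hv : q r with
        | none => exact hr ((hs' r).1 hv)
        | some w => 
          have := h _ _ hv
          simp [(h' r).none] at this
      simp [h1, h2]
  | succ k ih =>
    intro q hq hk r
    by_cases hr : q r = none
    swap
    · have h1 : cmp q r = ∅ := by
        ext v; simp only [cmp, mem_filter, mem_univ, true_and, notMem_empty, iff_false]
        intro h
        exact hr h.none
      have h2 : Cr q r = ∅ := by
        ext p
        simp only [Cr, mem_filter, mem_univ, true_and, notMem_empty, iff_false]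
        rintro ⟨h, h'⟩
        obtain ⟨w, hw⟩ := Option.ne_none_iff_exists'.1 hr
        have := h _ _ hw
        simp [(h' r).none] at this
      simp [h1, h2]
    obtain ⟨s, hs, hsr⟩ : ∃ s ∈ rts q, s ≠ r := by
      apply Finset.exists_mem_ne
      omega
    have hs0 : q s = none := by simpa [rts] using hs
    -- decompose
    have hdec : #(Cr q r) = ∑ y ∈ (cmp q s)ᶜ, #(Cr (Function.update q s (some y)) r) := by
      rw [← card_biUnion]
      · congr 1
        ext p
        simp only [Cr, cmp, mem_filter, mem_univ, true_and, mem_biUnion, mem_compl]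
        constructor
        · rintro ⟨h, h'⟩
          obtain ⟨y, hy⟩ : ∃ y, p s = some y := by
            cases hps : p s with
            | none => exact absurd ((RootOf.base hps).uniq (h' s)) hsr
            | some y => exact ⟨y, rfl⟩
          refine ⟨y, fun hb => not_forest_update h (fun v => ⟨r, h' v⟩) hy hb, ?_, h'⟩
          intro v w hv
          by_cases hvs : v = s
          · subst hvs; simp at hv; rw [hy, hv]
          · rw [Function.update_of_ne hvs] at hv; exact h _ _ hv
        · rintro ⟨y, hy, h, h'⟩
          exact ⟨fun v w hv => h _ _ (sub_update hs0 _ _ _ hv), h'⟩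
      · intro y _ z _ hyz
        rw [Function.onFun, Finset.disjoint_left]
        simp only [Cr, mem_filter, mem_univ, true_and, not_and]
        rintro p ⟨h1, _⟩ h2
        have e1 := h1 s y (by simp)
        have e2 := h2 s z (by simp)
        rw [e1] at e2
        cases e2
        exact absurd rfl hyz
    have hrts : ∀ y, #(rts (Function.update q s (some y))) = k + 1 := by
      intro y
      have : rts (Function.update q s (some y)) = (rts q).erase s := by
        ext v
        simp only [rts, mem_filter, mem_univ, true_and, mem_erase, Function.update_apply]
        split_ifs with h <;> simp [h]
      rw [this, card_erase_of_mem hs, hk]; rfl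
    have hstep : ∀ y ∈ (cmp q s)ᶜ, Fintype.card V * #(Cr (Function.update q s (some y)) r)
        = (#(cmp q r) + if y ∈ cmp q r then #(cmp q s) else 0) * Fintype.card V ^ k := by
      intro y hy
      have hy' : ¬ RootOf q y s := by simpa [cmp] using hy
      rw [ih _ (forest_update hq hs0 hy') (hrts y)]
      congr 1
      obtain ⟨t, ht⟩ := hq y
      have hts : t ≠ s := by rintro rfl; exact hy' ht
      have hiff := rootOf_update_iff hq hs0 ht hts
      split_ifs with h
      · have : t = r := ht.uniq (by simpa [cmp] using h)
        subst this
        rw [← card_union_of_disjoint]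
        · congr 1
          ext v
          simp [cmp, hiff, hts]
        · rw [Finset.disjoint_left]
          simp only [cmp, mem_filter, mem_univ, true_and]
          intro v h1 h2
          exact hts (h1.uniq h2)
      · have htr : r ≠ t := by rintro rfl; exact h (by simpa [cmp] using ht)
        rw [add_zero]
        congr 1
        ext v
        simp [cmp, hiff, hsr.symm, htr]
    have hsub : cmp q r ⊆ (cmp q s)ᶜ := by
      intro v
      simp only [cmp, mem_filter, mem_univ, true_and, mem_compl]
      intro h1 h2
      exact hsr (h2.uniq h1)
    rw [hdec, mul_sum, sum_congr rfl hstep, ← sum_mul, sum_add_distrib, sum_const,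
      ← sum_filter, sum_const]
    have : filter (fun y => y ∈ cmp q r) (cmp q s)ᶜ = cmp q r := by
      ext v; simp only [mem_filter]; exact ⟨fun h => h.2, fun h => ⟨hsub h, h⟩⟩
    rw [this, pow_succ, ← Finset.card_add_card_compl (cmp q s)]
    simp only [smul_eq_mul]
    ring

open Classical in
noncomputable def Ct (q : V → Option V) : Finset (V → Option V) :=
  {p | Sub q p ∧ ∃ r, ∀ v, RootOf p v r}

theorem card_Ct [Nonempty V] (k : ℕ) (q : V → Option V) (hq : Forest q) (hk : #(rts q) = k + 1) :
    #(Ct q) = Fintype.card V ^ k := by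
  have h1 : #(Ct q) = ∑ r, #(Cr q r) := by
    rw [← card_biUnion]
    · congr 1
      ext p
      simp [Ct, Cr]
    · intro y _ z _ hyz
      rw [Function.onFun, Finset.disjoint_left]
      simp only [Cr, mem_filter, mem_univ, true_and, not_and]
      rintro p ⟨h1, h1'⟩ _ h2
      exact hyz ((h1' y).uniq (h2 y))
  have h2 : ∑ r, #(cmp q r) = Fintype.card V := by
    rw [← card_biUnion]
    · rw [← card_univ]
      congr 1
      ext v
      simpa [cmp] using hq v
    · intro y _ z _ hyz
      rw [Function.onFun, Finset.disjoint_left]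
      simp only [cmp, mem_filter, mem_univ, true_and]
      intro v h1 h2
      exact hyz (h1.uniq h2)
  have h3 : Fintype.card V * #(Ct q) = Fintype.card V * Fintype.card V ^ k := by
    rw [h1, mul_sum, sum_congr rfl (fun r _ => card_Cr k q hq hk r), ← sum_mul, h2]
  exact Nat.eq_of_mul_eq_mul_left Fintype.card_pos h3

theorem card_rts_pos [Nonempty V] (q : V → Option V) (hq : Forest q) : 0 < #(rts q) := by
  obtain ⟨r, hr⟩ := hq (Classical.arbitrary V)
  exact card_pos.2 ⟨r, by simpa [rts] using hr.none⟩

end completions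
end Pk

namespace Pk
open Finset
section park
variable {V : Type*} [DecidableEq V]

/-- parking, latest car at the head of the list -/
inductive PK (q : V → Option V) : List V → Finset V → Prop
  | nil : PK q [] ∅
  | cons {xs O v s} : PK q xs O → Drv q O v s → PK q (v :: xs) (insert s O)

theorem PK.uniq {q : V → Option V} {xs : List V} {O O' : Finset V} (h : PK q xs O)
    (h' : PK q xs O') : O = O' := by
  induction h generalizing O' with
  | nil => cases h'; rfl
  | cons h1 h2 ih =>
    cases h' with
    | cons h3 h4 =>
      have := ih h3
      subst this
      rw [h2.uniq h4]

theorem PK.mono {q p : V → Option V} (hqp : Sub q p) {xs : List V} {O : Finset V}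
    (h : PK q xs O) : PK p xs O := by
  induction h with
  | nil => exact .nil
  | cons h1 h2 ih => exact .cons ih (h2.mono hqp)

theorem PK.card {q : V → Option V} {xs : List V} {O : Finset V}
    (h : PK q xs O) : #O = xs.length := by
  induction h with
  | nil => rfl
  | cons h1 h2 ih => rw [card_insert_of_notMem h2.notMem, ih]; rfl

theorem Drv.start_mem {q : V → Option V} {O : Finset V} {v s : V} (h : Drv q O v s) :
    v ∈ insert s O := by
  cases h with
  | base h => simp
  | step h _ _ => simp [h]

theorem Drv.congr {q q' : V → Option V} {O U : Finset V} {v s : V} (h : Drv q O v s)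
    (hU : insert s O ⊆ U)
    (hq : ∀ v w, v ∈ O → q v = some w → w ∈ U → q' v = some w) : Drv q' O v s := by
  induction h with
  | base h => exact .base h
  | step h0 h1 h2 ih => exact .step h0 (hq _ _ h0 h1 (hU h2.start_mem)) (ih hU)

theorem PK.congr {q q' : V → Option V} {xs : List V} {O U : Finset V} (h : PK q xs O)
    (hU : O ⊆ U)
    (hq : ∀ v w, v ∈ U → q v = some w → w ∈ U → q' v = some w) : PK q' xs O := by
  induction h with
  | nil => exact .nil
  | cons h1 h2 ih =>
    have h3 := (subset_insert _ _).trans hU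
    exact .cons (ih h3) (h2.congr hU (fun v w hv => hq v w (h3 hv)))

def inf (q1 q2 : V → Option V) : V → Option V := fun v => if q1 v = q2 v then q1 v else none

theorem Drv.inf {p q1 q2 : V → Option V} (h1 : Sub q1 p) (h2 : Sub q2 p) {O : Finset V} {v s s' : V}
    (hd1 : Drv q1 O v s) (hd2 : Drv q2 O v s') : Drv (inf q1 q2) O v s := by
  induction hd1 with
  | base h => exact .base h
  | step ha hb hc ih =>
    cases hd2 with
    | base h => exact absurd ha h
    | step ha' hb' hc' =>
      have e1 := h1 _ _ hb
      have e2 := h2 _ _ hb'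
      rw [e1] at e2
      cases e2
      refine .step ha ?_ (ih hc')
      simp [Pk.inf, hb, hb']

theorem PK.inf {p q1 q2 : V → Option V} (h1 : Sub q1 p) (h2 : Sub q2 p) {xs : List V} 
    {O : Finset V} (hd1 : PK q1 xs O) (hd2 : PK q2 xs O) : PK (inf q1 q2) xs O := by
  induction hd1 with
  | nil => exact .nil
  | @cons xs O v s ha hb ih =>
    generalize hO' : insert s O = O' at hd2
    cases hd2 with
    | @cons _ O2 _ s2 hc hd =>
      have := (ha.mono h1).uniq (hc.mono h2)
      subst this
      rw [← hO']
      exact .cons (ih hc) (hb.inf h1 h2 hd)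

def Tight (q : V → Option V) (xs : List V) (O : Finset V) : Prop :=
  PK q xs O ∧ ∀ q', Sub q' q → PK q' xs O → q' = q

theorem inf_sub_left (q1 q2 : V → Option V) : Sub (inf q1 q2) q1 := by
  intro v w h
  simp only [inf] at h
  split_ifs at h with h'
  exact h

theorem inf_sub_right (q1 q2 : V → Option V) : Sub (inf q1 q2) q2 := by
  intro v w h
  simp only [inf] at h
  split_ifs at h with h'
  rw [← h', h]

theorem Tight.uniq {p q1 q2 : V → Option V} (h1 : Sub q1 p) (h2 : Sub q2 p) {xs : List V} 
    {O : Finset V} (hd1 : Tight q1 xs O) (hd2 : Tight q2 xs O) : q1 = q2 := by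
  have h := hd1.1.inf h1 h2 hd2.1
  exact (hd1.2 _ (inf_sub_left _ _) h).symm.trans (hd2.2 _ (inf_sub_right _ _) h)

variable [Fintype V]

theorem exists_tight {p : V → Option V} {xs : List V} {O : Finset V} (h : PK p xs O) :
    ∃ q, Sub q p ∧ Tight q xs O := by
  classical
  let S : Finset (V → Option V) := {q | Sub q p ∧ PK q xs O}
  have hS : S.Nonempty := ⟨p, by simp only [S, mem_filter, mem_univ, true_and]; exact ⟨fun _ _ h => h, h⟩⟩
  obtain ⟨q, hq, hmax⟩ := S.exists_max_image (fun q => #(rts q)) hS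
  simp only [S, mem_filter, mem_univ, true_and] at hq hmax
  refine ⟨q, hq.1, hq.2, ?_⟩
  intro q' h1 h2
  have h3 := hmax q' ⟨fun v w h => hq.1 _ _ (h1 _ _ h), h2⟩
  have h4 : rts q ⊆ rts q' := by
    intro v
    simp only [rts, mem_filter, mem_univ, true_and]
    intro hv
    cases h' : q' v with
    | none => rfl
    | some w => simp [h1 _ _ h'] at hv
  have h5 := eq_of_subset_of_card_le h4 h3
  ext1 v
  cases h' : q' v with
  | some w => exact (h1 _ _ h').symm
  | none =>
    have : v ∈ rts q' := by simpa [rts] using h'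
    rw [← h5] at this
    symm
    simpa [rts] using this

theorem Tight.cmp {q : V → Option V} {xs : List V} {O : Finset V} (h : Tight q xs O) {r : V}
    (hr : r ∉ O) : cmp q r = {r} := by
  let q' : V → Option V := fun v => if v ∈ O then (q v).filter (· ∈ O) else none
  have hsub : Sub q' q := by
    intro v w h
    simp only [q'] at h
    split_ifs at h
    simp at h
    exact h.1
  have hq' : q' = q := by
    apply h.2 _ hsub
    apply h.1.congr (U := O) subset_rfl
    intro v w hv hvw hw
    simp [q', hv, hvw, hw]
  have h1 : q r = none := by rw [← hq']; simp [q', hr]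
  have h2 : ∀ u, q u ≠ some r := by
    intro u hu
    rw [← hq'] at hu
    simp only [q'] at hu
    split_ifs at hu
    simp at hu
    exact hr hu.2
  ext v
  simp only [Pk.cmp, mem_filter, mem_univ, true_and, mem_singleton]
  constructor
  · intro h
    clear h1 hr
    induction h with
    | base _ => rfl
    | step h3 h4 ih => 
      have := ih h2
      subst this
      exact absurd h3 (h2 _)
  · rintro rfl
    exact .base h1

open Classical in
noncomputable def Pf (xs : List V) (O : Finset V) : Finset (V → Option V) :=
  {p | (∃ r, ∀ v, RootOf p v r) ∧ PK p xs O}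
open Classical in
noncomputable def Rf (xs : List V) (O : Finset V) : Finset (V → Option V) :=
  {p | (∃ r, (∀ v, RootOf p v r) ∧ r ∉ O) ∧ PK p xs O}
open Classical in
noncomputable def Fl (xs : List V) (O : Finset V) : Finset (V → Option V) :=
  {q | Forest q ∧ PK q xs O ∧ rts q = Oᶜ}

theorem card_Rf_Pf [Nonempty V] (xs : List V) (O : Finset V) :
    Fintype.card V * #(Rf xs O) = (Fintype.card V - xs.length) * #(Pf xs O) := by
  classical
  let T : Finset (V → Option V) := {q | Forest q ∧ Tight q xs O}
  have hP : #(Pf xs O) = ∑ q ∈ T, #(Ct q) := by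
    rw [← card_biUnion]
    · congr 1
      ext p
      simp only [Pf, T, Ct, mem_filter, mem_univ, true_and, mem_biUnion]
      constructor
      · rintro ⟨⟨r, hr⟩, h⟩
        obtain ⟨q, h1, h2⟩ := exists_tight h
        exact ⟨q, ⟨h1.forest (fun v => ⟨r, hr v⟩), h2⟩, h1, r, hr⟩
      · rintro ⟨q, ⟨h1, h2⟩, h3, h4⟩
        exact ⟨h4, h2.1.mono h3⟩
    · intro y hy z hz hyz
      rw [Function.onFun, Finset.disjoint_left]
      simp only [T, Ct, coe_filter, mem_univ, true_and, Set.mem_ofPred_eq, mem_filter] at hy hz ⊢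
      rintro p ⟨h1, _⟩ ⟨h2, _⟩
      exact hyz (Tight.uniq h1 h2 hy.2 hz.2)
  have hR : #(Rf xs O) = ∑ q ∈ T, ∑ r ∈ Oᶜ, #(Cr q r) := by
    rw [← sum_product', ← card_biUnion]
    · congr 1
      ext p
      simp only [Rf, T, Cr, mem_filter, mem_univ, true_and, mem_biUnion, mem_product, mem_compl,
        Prod.exists]
      constructor
      · rintro ⟨⟨r, hr, hrO⟩, h⟩
        obtain ⟨q, h1, h2⟩ := exists_tight h
        exact ⟨q, r, ⟨⟨h1.forest (fun v => ⟨r, hr v⟩), h2⟩, hrO⟩, h1, hr⟩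
      · rintro ⟨q, r, ⟨⟨h1, h2⟩, hrO⟩, h3, h4⟩
        exact ⟨⟨r, h4, hrO⟩, h2.1.mono h3⟩
    · rintro ⟨y, r⟩ hy ⟨z, s⟩ hz hyz
      rw [Function.onFun, Finset.disjoint_left]
      simp only [T, Cr, coe_product, Set.mem_prod, coe_filter, mem_univ, true_and, Set.mem_ofPred_eq, mem_filter] at hy hz ⊢
      rintro p ⟨h1, h1'⟩ ⟨h2, h2'⟩
      apply hyz
      rw [Tight.uniq h1 h2 hy.1.2 hz.1.2, (h1' r).uniq (h2' r)]
  rw [hP, hR, mul_sum, mul_sum]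
  apply sum_congr rfl
  intro q hq
  simp only [T, mem_filter, mem_univ, true_and] at hq
  obtain ⟨k, hk⟩ := Nat.exists_eq_succ_of_ne_zero (card_rts_pos q hq.1).ne'
  rw [mul_sum, card_Ct k q hq.1 hk]
  have : ∀ r ∈ Oᶜ, Fintype.card V * #(Cr q r) = Fintype.card V ^ k := by
    intro r hr
    rw [card_Cr k q hq.1 hk, hq.2.cmp (by simpa using hr)]
    simp
  rw [sum_congr rfl this, sum_const, card_compl, hq.2.1.card, smul_eq_mul]

theorem card_Rf_Fl [Nonempty V] (xs : List V) (O : Finset V) :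
    #(Rf xs O) = Fintype.card V ^ (Fintype.card V - xs.length - 1) * #(Fl xs O) := by
  classical
  have hR : #(Rf xs O) = ∑ q ∈ Fl xs O, #(Ct q) := by
    rw [← card_biUnion]
    · congr 1
      ext p
      simp only [Rf, Fl, Ct, mem_filter, mem_univ, true_and, mem_biUnion]
      constructor
      · rintro ⟨⟨r, hr, hrO⟩, h⟩
        have hsub : Sub (fun v => if v ∈ O then p v else none) p := by
          intro v w h
          simp only at h
          split_ifs at h
          exact h
        refine ⟨fun v => if v ∈ O then p v else none, ⟨hsub.forest (fun v => ⟨r, hr v⟩), ?_, ?_⟩, hsub, r, hr⟩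
        · apply h.congr (U := O) subset_rfl
          intro v w hv hvw hw
          simp [hv, hvw]
        · ext v
          simp only [rts, mem_filter, mem_univ, true_and, mem_compl, ite_eq_right_iff]
          constructor
          · intro h hv
            have := (RootOf.base (h hv)).uniq (hr v)
            subst this
            exact hrO hv
          · intro h h'; exact absurd h' h
      · rintro ⟨q, ⟨h1, h2, h3⟩, h4, r, h5⟩
        refine ⟨⟨r, h5, ?_⟩, h2.mono h4⟩
        rw [← mem_compl, ← h3]
        simp only [rts, mem_filter, mem_univ, true_and]
        cases hv : q r with
        | none => rfl
        | some w => 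
          have := h4 _ _ hv
          simp [(h5 r).none] at this
    · intro y hy z hz hyz
      rw [Function.onFun, Finset.disjoint_left]
      simp only [Fl, Ct, coe_filter, mem_univ, true_and, Set.mem_ofPred_eq, mem_filter] at hy hz ⊢
      rintro p ⟨h1, _⟩ ⟨h2, _⟩
      apply hyz
      have e : rts y = rts z := hy.2.2.trans hz.2.2.symm
      ext1 v
      have e' := congrArg (v ∈ ·) e
      simp only [rts, mem_filter, mem_univ, true_and, eq_iff_iff] at e'
      cases hv : y v with
      | none => exact (e'.1 hv).symm
      | some w =>
        cases hv' : z v with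
        | none => simp [e'.2 hv'] at hv
        | some w' => rw [← h1 _ _ hv, ← h2 _ _ hv']
  rw [hR, mul_comm, ← smul_eq_mul, ← sum_const]
  apply sum_congr rfl
  intro q hq
  simp only [Fl, mem_filter, mem_univ, true_and] at hq
  obtain ⟨k, hk⟩ := Nat.exists_eq_succ_of_ne_zero (card_rts_pos q hq.1).ne'
  rw [card_Ct k q hq.1 hk]
  rw [hq.2.2, card_compl, hq.2.1.card] at hk
  rw [hk]; rfl

end park

section uf
variable {V : Type*} [DecidableEq V]

inductive UF : List (V × V) → (V → Option V) → Prop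
  | nil : UF [] (fun _ => none)
  | cons {es q a b s t} : UF es q → RootOf q a s → RootOf q b t → s ≠ t →
      UF ((a, b) :: es) (Function.update q s (some b))

def Gr (es : List (V × V)) : SimpleGraph V :=
  SimpleGraph.fromEdgeSet {z | z ∈ es.map (fun e => s(e.1, e.2))}

def AcL (es : List (V × V)) : Prop :=
  (∀ e ∈ es, e.1 ≠ e.2) ∧ (es.map (fun e => s(e.1, e.2))).Nodup ∧ (Gr es).IsAcyclic

theorem Gr_cons (a b : V) (es : List (V × V)) : Gr ((a, b) :: es) = Gr es ⊔ SimpleGraph.edge a b := by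
  ext u v
  simp only [Gr, SimpleGraph.fromEdgeSet_adj, List.map_cons, List.mem_cons, Set.mem_ofPred_eq,
    SimpleGraph.sup_adj, SimpleGraph.edge_adj, Sym2.eq_iff]
  tauto

theorem AcL_cons (a b : V) (es : List (V × V)) :
    AcL ((a, b) :: es) ↔ AcL es ∧ ¬ (Gr es).Reachable a b := by
  simp only [AcL, Gr_cons, SimpleGraph.isAcyclic_sup_fromEdgeSet_iff, List.forall_mem_cons,
    List.map_cons, List.nodup_cons]
  have hadj : (Gr es).Adj a b ↔ s(a,b) ∈ es.map (fun e => s(e.1, e.2)) ∧ a ≠ b := by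
    simp only [Gr, SimpleGraph.fromEdgeSet_adj, Set.mem_ofPred_eq]
  constructor
  · rintro ⟨⟨h1, h2⟩, ⟨h3, h4⟩, h5, h6⟩
    refine ⟨⟨h2, h4, h5⟩, fun h => ?_⟩
    rcases h6 h with h | h
    · exact h1 h
    · exact h3 (hadj.1 h).1
  · rintro ⟨⟨h2, h4, h5⟩, h⟩
    have hab : a ≠ b := by rintro rfl; exact h (.refl _)
    exact ⟨⟨hab, h2⟩, ⟨fun h' => h (hadj.2 ⟨h', hab⟩).reachable, h4⟩, h5, fun h' => absurd h' h⟩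

theorem UF.inv {es : List (V × V)} {q : V → Option V} (h : UF es q) :
    Forest q ∧ ∀ u v, (Gr es).Reachable u v ↔ ∃ r, RootOf q u r ∧ RootOf q v r := by
  induction h with
  | nil =>
    have hG : Gr ([] : List (V × V)) = ⊥ := by simp [Gr]
    have hr : ∀ u : V, RootOf (fun _ => none) u u := fun u => .base rfl
    refine ⟨fun v => ⟨v, hr v⟩, fun u v => ?_⟩
    rw [hG, SimpleGraph.reachable_bot]
    constructor
    · rintro rfl; exact ⟨u, hr u, hr u⟩
    · rintro ⟨r, h1, h2⟩
      rw [(hr u).uniq h1, (hr v).uniq h2]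
  | @cons es q a b s t h ha hb hst ih =>
    obtain ⟨hF, hR⟩ := ih
    have hs := ha.none
    have hF' := forest_update hF hs (fun h => hst (h.uniq hb))
    have hiff := rootOf_update_iff hF hs hb hst.symm
    refine ⟨hF', fun u v => ?_⟩
    rw [Gr_cons]
    have hle : Gr es ≤ Gr es ⊔ SimpleGraph.edge a b := le_sup_left
    have hab : (Gr es ⊔ SimpleGraph.edge a b).Adj a b := by
      have : a ≠ b := by rintro rfl; exact hst (ha.uniq hb)
      simp [SimpleGraph.edge_adj, this]
    have hroot : ∀ x y, RootOf q x y → (Gr es ⊔ SimpleGraph.edge a b).Reachable x y := by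
      intro x y h
      exact ((hR x y).2 ⟨y, h, .base h.none⟩).mono hle
    have hroot' : ∀ x y, RootOf (Function.update q s (some b)) x y →
        (Gr es ⊔ SimpleGraph.edge a b).Reachable x y := by
      intro x y h
      rcases (hiff x y).1 h with ⟨h1, _⟩ | ⟨h1, rfl⟩
      · exact hroot _ _ h1
      · exact (hroot _ _ h1).trans ((hroot _ _ ha).symm.trans (hab.reachable.trans (hroot _ _ hb)))
    constructor
    · rintro ⟨w⟩
      induction w with
      | nil => 
        obtain ⟨r, hr⟩ := hF' ‹_›
        exact ⟨r, hr, hr⟩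
      | @cons x y z hxy w ihw =>
        obtain ⟨r, h1, h2⟩ := ihw
        refine ⟨r, ?_, h2⟩
        obtain ⟨c, hc1, hc2⟩ : ∃ c, RootOf (Function.update q s (some b)) x c ∧
            RootOf (Function.update q s (some b)) y c := by
          have eab : RootOf (Function.update q s (some b)) a t := (hiff a t).2 (.inr ⟨ha, rfl⟩)
          have ebb : RootOf (Function.update q s (some b)) b t := (hiff b t).2 (.inl ⟨hb, hst.symm⟩)
          rw [SimpleGraph.sup_adj, SimpleGraph.edge_adj] at hxy
          rcases hxy with hxy | ⟨⟨rfl, rfl⟩ | ⟨rfl, rfl⟩, _⟩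
          · obtain ⟨c, hc1, hc2⟩ := (hR x y).1 hxy.reachable
            by_cases hcs : c = s
            · subst hcs
              exact ⟨t, (hiff _ _).2 (.inr ⟨hc1, rfl⟩), (hiff _ _).2 (.inr ⟨hc2, rfl⟩)⟩
            · exact ⟨c, (hiff _ _).2 (.inl ⟨hc1, hcs⟩), (hiff _ _).2 (.inl ⟨hc2, hcs⟩)⟩
          · exact ⟨t, eab, ebb⟩
          · exact ⟨t, ebb, eab⟩
        rwa [hc2.uniq h1] at hc1
    · rintro ⟨r, h1, h2⟩
      exact (hroot' _ _ h1).trans (hroot' _ _ h2).symm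

theorem UF.uniq {es : List (V × V)} {q q' : V → Option V} (h : UF es q) (h' : UF es q') :
    q = q' := by
  induction h generalizing q' with
  | nil => cases h'; rfl
  | cons h1 h2 h3 h4 ih =>
    cases h' with
    | cons h5 h6 h7 h8 =>
      have := ih h5
      subst this
      rw [h2.uniq h6]

theorem AcL_iff (es : List (V × V)) : AcL es ↔ ∃ q, UF es q := by
  induction es with
  | nil =>
    refine ⟨fun _ => ⟨_, .nil⟩, fun _ => ?_⟩
    simp [AcL, Gr]
  | cons e es ih =>
    obtain ⟨a, b⟩ := e
    rw [AcL_cons, ih]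
    constructor
    · rintro ⟨⟨q, hq⟩, h⟩
      obtain ⟨s, hs⟩ := hq.inv.1 a
      obtain ⟨t, ht⟩ := hq.inv.1 b
      refine ⟨_, .cons hq hs ht ?_⟩
      rintro rfl
      exact h ((hq.inv.2 _ _).2 ⟨s, hs, ht⟩)
    · rintro ⟨q, hq⟩
      cases hq with
      | cons h1 h2 h3 h4 =>
        refine ⟨⟨_, h1⟩, fun h => ?_⟩
        obtain ⟨r, h5, h6⟩ := (h1.inv.2 _ _).1 h
        exact h4 ((h2.uniq h5).trans (h6.uniq h3))

variable [Fintype V]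

def Full (q : V → Option V) (xs : List V) : Prop := Forest q ∧ PK q xs (rts q)ᶜ

theorem rts_update (q : V → Option V) (s b : V) : 
    (rts (Function.update q s (some b)))ᶜ = insert s (rts q)ᶜ := by
  ext v
  simp only [rts, mem_compl, mem_filter, mem_univ, true_and, mem_insert, Function.update_apply]
  split_ifs with h <;> simp [h]

theorem UF.full {es : List (V × V)} {q : V → Option V} (h : UF es q) :
    Full q (es.map Prod.fst) := by
  refine ⟨h.inv.1, ?_⟩
  induction h with
  | nil =>
    have : (rts (fun _ : V => none))ᶜ = (∅ : Finset V) := by ext; simp [rts]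
    rw [this]; exact .nil
  | @cons es q a b s t h ha hb hst ih =>
    rw [rts_update]
    refine .cons (ih.mono (sub_update ha.none _)) (Drv.mono (sub_update ha.none _) ?_)
    clear ih h
    induction ha with
    | base h => exact .base (by simp [rts, h])
    | step h1 h2 ih => exact .step (by simp [rts, h1]) h1 (ih hst)

theorem full_decomp {q : V → Option V} {xs : List V} {v : V} (h : Full q (v :: xs)) :
    ∃ s O b, PK q xs O ∧ Drv q O v s ∧ (rts q)ᶜ = insert s O ∧ q s = some b ∧
      Full (Function.update q s none) xs ∧ RootOf (Function.update q s none) v s ∧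
      ¬ RootOf (Function.update q s none) b s := by
  obtain ⟨hF, hP⟩ := h
  generalize hO : (rts q)ᶜ = O' at hP
  cases hP with
  | @cons _ O _ s h1 h2 =>
    have hmem : ∀ u, q u ≠ none ↔ u = s ∨ u ∈ O := by
      intro u
      have := congrArg (u ∈ ·) hO
      simpa [rts] using this
    obtain ⟨b, hb⟩ := Option.ne_none_iff_exists'.1 ((hmem s).2 (.inl rfl))
    have hsO := h2.notMem
    have hne : ∀ u ∈ O, u ≠ s := by rintro u hu rfl; exact hsO hu
    refine ⟨s, O, b, h1, h2, rfl, hb, ⟨update_sub.forest hF, ?_⟩, ?_, ?_⟩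
    · have : (rts (Function.update q s none))ᶜ = O := by
        ext u
        simp only [rts, mem_compl, mem_filter, mem_univ, true_and, Function.update_apply]
        split_ifs with h
        · subst h; simpa using hsO
        · rw [← ne_eq, hmem]; simp [h]
      rw [this]
      apply h1.congr (U := O) subset_rfl
      intro v w hv hvw _
      rwa [Function.update_of_ne (hne v hv)]
    · clear hO hF h1
      induction h2 with
      | @base v h => exact .base (by simp)
      | step h3 h4 h5 ih =>
        refine .step ?_ (ih hmem hb hsO hne)
        rwa [Function.update_of_ne (hne _ h3)]
    · intro h
      exact not_forest_update update_sub hF hb h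

theorem exists_UF {xs : List V} : ∀ {q : V → Option V}, Full q xs →
    ∃ es, UF es q ∧ es.map Prod.fst = xs := by
  induction xs with
  | nil =>
    rintro q ⟨_, h⟩
    refine ⟨[], ?_, rfl⟩
    generalize hO : (rts q)ᶜ = O at h
    cases h
    have : q = fun _ => none := by
      ext1 v
      have := congrArg (v ∈ ·) hO
      simpa [rts] using this
    rw [this]; exact .nil
  | cons v xs ih =>
    intro q h
    obtain ⟨s, O, b, h1, h2, h3, h4, h5, h6, h7⟩ := full_decomp h
    obtain ⟨es, he, hx⟩ := ih h5
    refine ⟨(v, b) :: es, ?_, by simp [hx]⟩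
    obtain ⟨t, ht⟩ := h5.1 b
    have := UF.cons he h6 ht (by rintro rfl; exact h7 ht)
    rwa [Function.update_idem, ← h4, Function.update_eq_self] at this

theorem UF.inj {es es' : List (V × V)} {q : V → Option V} (h : UF es q) (h' : UF es' q)
    (hx : es.map Prod.fst = es'.map Prod.fst) : es = es' := by
  induction h generalizing es' with
  | nil => simpa using hx.symm
  | @cons es q a b s t h1 h2 h3 h4 ih =>
    generalize hq : Function.update q s (some b) = q' at h'
    cases h' with
    | nil => simp at hx
    | @cons es' q2 a' b' s' t' h5 h6 h7 h8 =>
      simp only [List.map_cons, List.cons.injEq] at hx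
      obtain ⟨hx1, hx2⟩ := hx
      subst hx1
      have p1 := h1.full
      have p2 := h5.full
      have e1 := p1.2.mono (sub_update h2.none (some b))
      have e2 := p2.2.mono (sub_update h6.none (some b'))
      rw [← hq, ← hx2] at e2
      have e3 := e1.uniq e2
      have e4 := rts_update q s b
      rw [hq, rts_update, e3] at e4
      have hs : s ∉ (rts q2)ᶜ := by rw [← e3]; simp [rts, h2.none]
      have hss : s = s' := by
        have : s ∈ insert s' (rts q2)ᶜ := by rw [e4]; simp
        rcases mem_insert.1 this with h | h
        · exact h
        · exact absurd h hs
      subst hss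
      have hb : some b = some b' := by
        have := congrFun hq s
        simpa using this
      cases hb
      have hqq : q = q2 := by
        ext1 u
        by_cases hu : u = s
        · subst hu; rw [h2.none, h6.none]
        · have := congrFun hq u
          simpa [hu] using this
      subst hqq
      rw [ih h5 hx2]

end uf
end Pk

namespace Pk
open Finset

theorem pstep_none {n : ℕ} (p : Fin n → Option (Fin n)) (k : ℕ) : (pstep p)^[k] none = none := by
  induction k with
  | zero => rfl
  | succ k ih => rw [Function.iterate_succ_apply]; exact ih

theorem forest_iff {n : ℕ} (p : Fin n → Option (Fin n)) : IsRootedForest p ↔ Forest p := by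
  constructor
  · intro h v
    have key : ∀ k v, (pstep p)^[k] (some v) = none → ∃ r, RootOf p v r := by
      intro k
      induction k with
      | zero => intro v h; simp at h
      | succ k ih =>
        intro v h
        rw [Function.iterate_succ_apply] at h
        cases hv : p v with
        | none => exact ⟨v, .base hv⟩
        | some w =>
          have : pstep p (some v) = some w := by simp [pstep, hv]
          rw [this] at h
          obtain ⟨r, hr⟩ := ih w h
          exact ⟨r, .step hv hr⟩
    exact key n v (h v)
  · intro h v
    have hex : ∃ k, (pstep p)^[k] (some v) = none := by
      obtain ⟨r, hr⟩ := h v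
      induction hr with
      | base h => exact ⟨1, by simp [pstep, h]⟩
      | step h1 h2 ih =>
        obtain ⟨k, hk⟩ := ih
        refine ⟨k + 1, ?_⟩
        rw [Function.iterate_succ_apply]
        simpa [pstep, h1] using hk
    by_contra hne
    classical
    let k := Nat.find hex
    have hk : (pstep p)^[k] (some v) = none := Nat.find_spec hex
    have hmin : ∀ j < k, (pstep p)^[j] (some v) ≠ none := fun j hj => Nat.find_min hex hj
    have hnk : n < k := by
      by_contra hkn
      push Not at hkn
      have h2 : ∀ j, k ≤ j → (pstep p)^[j] (some v) = none := by
        intro j hj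
        obtain ⟨d, rfl⟩ := Nat.exists_eq_add_of_le' hj
        rw [Function.iterate_add_apply, hk, pstep_none]
      exact hne (h2 n hkn)
    have hs : ∀ i : Fin (n + 1), ∃ w, (pstep p)^[i.1] (some v) = some w := fun i =>
      Option.ne_none_iff_exists'.1 (hmin i.1 (by omega))
    choose f hf using hs
    obtain ⟨i, j, hlt, hfij⟩ : ∃ i j, i < j ∧ f i = f j := by
      obtain ⟨i, j, hij, hfij⟩ := Fintype.exists_ne_map_eq_of_card_lt f (by simp)
      rcases lt_or_gt_of_ne hij with h | h
      · exact ⟨i, j, h, hfij⟩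
      · exact ⟨j, i, h, hfij.symm⟩
    have he : (pstep p)^[i.1] (some v) = (pstep p)^[j.1] (some v) := by rw [hf, hf, hfij]
    have hlt' : i.1 < j.1 := hlt
    have hj := j.2
    apply hmin (k - j.1 + i.1) (by omega)
    rw [Function.iterate_add_apply, he, ← Function.iterate_add_apply]
    rw [Nat.sub_add_cancel (by omega)]
    exact hk

theorem tree_iff {n : ℕ} (p : Fin n → Option (Fin n)) :
    IsRootedTree p ↔ ∃ r, ∀ v, RootOf p v r := by
  unfold IsRootedTree
  rw [forest_iff]
  constructor
  · rintro ⟨h, r, hr, hu⟩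
    refine ⟨r, fun v => ?_⟩
    obtain ⟨s, hs⟩ := h v
    rwa [hu s hs.none] at hs
  · rintro ⟨r, hr⟩
    refine ⟨fun v => ⟨r, hr v⟩, r, (hr r).none, fun y hy => ?_⟩
    exact (RootOf.base hy).uniq (hr y)

theorem drive_iff {n : ℕ} (p : Fin n → Option (Fin n)) (O : Finset (Fin n)) (k : ℕ) :
    ∀ v s, (pstep p)^[k] (some v) = none → (drive p O k v = some s ↔ Drv p O v s) := by
  induction k with
  | zero => intro v s h; simp at h
  | succ k ih =>
    intro v s h
    rw [Function.iterate_succ_apply] at h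
    unfold drive
    split_ifs with hv
    · cases hp : p v with
      | none =>
        simp only [Option.bind_none, reduceCtorEq, false_iff]
        intro hd
        cases hd with
        | base h => exact h hv
        | step _ h _ => simp [hp] at h
      | some w =>
        have : pstep p (some v) = some w := by simp [pstep, hp]
        rw [this] at h
        rw [Option.bind_some, ih w s h]
        constructor
        · exact .step hv hp
        · intro hd
          cases hd with
          | base h => exact absurd hv h
          | step _ h1 h2 => rw [hp] at h1; cases h1; exact h2
    · constructor
      · intro h
        cases h
        exact .base hv
      · intro hd
        cases hd with
        | base h => rfl
        | step h _ _ => exact absurd h hv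

theorem parkAll_append {n : ℕ} (p : Fin n → Option (Fin n)) (xs : List (Fin n)) (v : Fin n) :
    ∀ O, parkAll p O (xs ++ [v]) =
      (parkAll p O xs).bind (fun O' => (drive p O' n v).map (fun s => insert s O')) := by
  induction xs with
  | nil =>
    intro O
    simp only [List.nil_append, parkAll, Option.bind_some]
    cases drive p O n v <;> rfl
  | cons x xs ih =>
    intro O
    simp only [List.cons_append, parkAll]
    cases drive p O n x with
    | none => rfl
    | some s => exact ih _

theorem parkAll_iff {n : ℕ} (p : Fin n → Option (Fin n)) (hp : IsRootedForest p)
    (xs : List (Fin n)) : ∀ O, parkAll p ∅ xs = some O ↔ PK p xs.reverse O := by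
  induction xs using List.reverseRecOn with
  | nil =>
    intro O
    simp only [parkAll, List.reverse_nil]
    constructor
    · intro h; cases h; exact .nil
    · intro h; cases h; rfl
  | append_singleton xs v ih =>
    intro O
    rw [parkAll_append, List.reverse_append]
    simp only [Option.bind_eq_some_iff, Option.map_eq_some_iff, List.reverse_singleton,
      List.singleton_append]
    constructor
    · rintro ⟨O', h1, s, h2, rfl⟩
      exact .cons ((ih _).1 h1) ((drive_iff p O' n v s (hp v)).1 h2)
    · intro h
      cases h with
      | cons h1 h2 => exact ⟨_, (ih _).2 h1, _, (drive_iff p _ n v _ (hp v)).2 h2, rfl⟩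

theorem card_triple {A B C : Type*} [Fintype A] [Fintype B] [Fintype C] [DecidableEq C]
    (F : A → B → Finset C) :
    Nat.card {t : A × B × C // t.2.2 ∈ F t.1 t.2.1} = ∑ a, ∑ b, #(F a b) := by
  classical
  rw [Nat.card_eq_fintype_card, Fintype.card_subtype, card_filter, Fintype.sum_prod_type]
  refine sum_congr rfl fun a _ => ?_
  rw [Fintype.sum_prod_type]
  refine sum_congr rfl fun b _ => ?_
  simp

theorem PF_eq (n m : ℕ) : PF n m =
    ∑ x : Fin m → Fin n, ∑ O : Finset (Fin n), #(Pf (List.ofFn x).reverse O) := by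
  classical
  rw [← card_triple]
  symm
  apply Nat.card_congr
  refine Equiv.ofBijective (fun t => ⟨(t.1.2.2, t.1.1), ?_⟩) ⟨?_, ?_⟩
  · have := t.2
    simp only [Pf, mem_filter, mem_univ, true_and] at this
    have ht := (tree_iff _).2 this.1
    refine ⟨ht, ?_⟩
    rw [Option.isSome_iff_exists]
    exact ⟨_, (parkAll_iff _ ht.1 _ _).2 this.2⟩
  · rintro ⟨⟨x, O, p⟩, h⟩ ⟨⟨x', O', p'⟩, h'⟩ he
    simp only [Subtype.mk.injEq, Prod.mk.injEq] at he ⊢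
    obtain ⟨rfl, rfl⟩ := he
    simp only [Pf, mem_filter, mem_univ, true_and] at h h'
    exact ⟨rfl, h.2.uniq h'.2, rfl⟩
  · rintro ⟨⟨p, x⟩, h1, h2⟩
    obtain ⟨O, hO⟩ := Option.isSome_iff_exists.1 h2
    refine ⟨⟨(x, O, p), ?_⟩, rfl⟩
    simp only [Pf, mem_filter, mem_univ, true_and]
    exact ⟨(tree_iff _).1 h1, (parkAll_iff _ h1.1 _ _).1 hO⟩

theorem PFroot_eq (n m : ℕ) : PFroot n m =
    ∑ x : Fin m → Fin n, ∑ O : Finset (Fin n), #(Rf (List.ofFn x).reverse O) := by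
  classical
  rw [← card_triple]
  symm
  apply Nat.card_congr
  refine Equiv.ofBijective (fun t => ⟨(t.1.2.2, t.1.1), ?_⟩) ⟨?_, ?_⟩
  · have := t.2
    simp only [Rf, mem_filter, mem_univ, true_and] at this
    obtain ⟨⟨r, h1, h2⟩, h3⟩ := this
    have ht := (tree_iff _).2 ⟨r, h1⟩
    refine ⟨ht, _, (parkAll_iff _ ht.1 _ _).2 h3, fun s hs => ?_⟩
    rwa [(RootOf.base hs).uniq (h1 s)]
  · rintro ⟨⟨x, O, p⟩, h⟩ ⟨⟨x', O', p'⟩, h'⟩ he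
    simp only [Subtype.mk.injEq, Prod.mk.injEq] at he ⊢
    obtain ⟨rfl, rfl⟩ := he
    simp only [Rf, mem_filter, mem_univ, true_and] at h h'
    exact ⟨rfl, h.2.uniq h'.2, rfl⟩
  · rintro ⟨⟨p, x⟩, h1, O, hO, h2⟩
    refine ⟨⟨(x, O, p), ?_⟩, rfl⟩
    simp only [Rf, mem_filter, mem_univ, true_and]
    obtain ⟨r, hr⟩ := (tree_iff _).1 h1
    exact ⟨⟨r, hr, h2 r (hr r).none⟩, (parkAll_iff _ h1.1 _ _).1 hO⟩

def Ace {n m : ℕ} (e : Fin m → Fin n × Fin n) : Prop :=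
  (∀ i, (e i).1 ≠ (e i).2) ∧
          Function.Injective (fun i => s((e i).1, (e i).2)) ∧
          (SimpleGraph.fromEdgeSet
            (Set.range fun i => s((e i).1, (e i).2))).IsAcyclic

theorem Ace_iff {n m : ℕ} (e : Fin m → Fin n × Fin n) : Ace e ↔ AcL (List.ofFn e).reverse := by
  unfold Ace AcL Gr
  have h1 : {z | z ∈ (List.ofFn e).reverse.map (fun e => s(e.1, e.2))} =
      Set.range fun i => s((e i).1, (e i).2) := by
    ext z
    simp [List.mem_ofFn]
  rw [h1]
  simp only [List.mem_reverse, List.mem_ofFn', Set.forall_mem_range, List.map_reverse,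
    List.nodup_reverse, List.map_ofFn, List.nodup_ofFn]
  rfl

theorem card_Ace (n m : ℕ) : Nat.card {e : Fin m → Fin n × Fin n // Ace e} =
    ∑ x : Fin m → Fin n, ∑ O : Finset (Fin n), #(Fl (List.ofFn x).reverse O) := by
  classical
  rw [← card_triple]
  apply Nat.card_congr
  have hex : ∀ e : {e : Fin m → Fin n × Fin n // Ace e}, ∃ q, UF (List.ofFn e.1).reverse q :=
    fun e => (AcL_iff _).1 ((Ace_iff _).1 e.2)
  choose f hf using hex
  have hmap : ∀ e : Fin m → Fin n × Fin n, (List.ofFn e).reverse.map Prod.fst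
      = (List.ofFn (fun i => (e i).1)).reverse := by
    intro e
    rw [List.map_reverse, List.map_ofFn]; rfl
  refine Equiv.ofBijective (fun e => ⟨(fun i => (e.1 i).1, (rts (f e))ᶜ, f e), ?_⟩) ⟨?_, ?_⟩
  · have := (hf e).full
    simp only [Fl, mem_filter, mem_univ, true_and, compl_compl, and_true]
    rw [← hmap]
    exact this
  · intro e e' he
    simp only [Subtype.mk.injEq, Prod.mk.injEq] at he
    obtain ⟨h1, _, h2⟩ := he
    have a1 := hf e
    have a2 := hf e'
    rw [← h2] at a2
    have := a1.inj a2 (by rw [hmap, hmap, h1])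
    exact Subtype.ext (List.ofFn_injective (List.reverse_injective this))
  · rintro ⟨⟨x, O, q⟩, h⟩
    simp only [Fl, mem_filter, mem_univ, true_and] at h
    obtain ⟨h1, h2, h3⟩ := h
    have hO : O = (rts q)ᶜ := by rw [h3, compl_compl]
    subst hO
    obtain ⟨es, he, hx⟩ := exists_UF (⟨h1, h2⟩ : Full q _)
    have hlen : es.reverse.length = m := by
      have := congrArg List.length hx
      simpa using this
    obtain ⟨e, he'⟩ : ∃ e : Fin m → Fin n × Fin n, List.ofFn e = es.reverse := by
      subst hlen
      exact ⟨es.reverse.get, List.ofFn_get _⟩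
    have hes : es = (List.ofFn e).reverse := by rw [he', List.reverse_reverse]
    subst hes
    have hA : Ace e := (Ace_iff e).2 ((AcL_iff _).2 ⟨q, he⟩)
    have hq : f ⟨e, hA⟩ = q := (hf ⟨e, hA⟩).uniq he
    refine ⟨⟨e, hA⟩, ?_⟩
    rw [hmap] at hx
    have := List.ofFn_injective (List.reverse_injective hx)
    simp only [hq, this]

theorem card_pairs {V : Type*} (z : Sym2 V) (hz : ¬ z.IsDiag) :
    Nat.card {x : V × V // s(x.1, x.2) = z} = 2 := by
  classical
  induction z with
  | _ a b =>
  have hab : a ≠ b := by simpa using hz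
  have : {x : V × V | s(x.1, x.2) = s(a, b)} = {(a, b), (b, a)} := by
    ext ⟨x, y⟩
    simp
  change Nat.card ({x : V × V | s(x.1, x.2) = s(a, b)} : Set _) = 2
  rw [this, Nat.card_coe_set_eq, Set.ncard_pair]
  simp [hab]

theorem card_Ace' (n m : ℕ) : Nat.card {e : Fin m → Fin n × Fin n // Ace e} =
    Nat.factorial m * 2 ^ m * forestCount n m := by
  classical
  let S := {σ : Fin m → Sym2 (Fin n) // (∀ i, ¬ (σ i).IsDiag) ∧ Function.Injective σ ∧
    (SimpleGraph.fromEdgeSet (Set.range σ)).IsAcyclic}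
  have h1 : Nat.card {e : Fin m → Fin n × Fin n // Ace e} = Nat.card S * 2 ^ m := by
    let E : {e : Fin m → Fin n × Fin n // Ace e} ≃
        Σ σ : S, (∀ i, {x : Fin n × Fin n // s(x.1, x.2) = σ.1 i}) :=
      { toFun := fun e => ⟨⟨fun i => s((e.1 i).1, (e.1 i).2), by
          have := e.2
          exact ⟨fun i => by simpa using this.1 i, this.2⟩⟩, fun i => ⟨e.1 i, rfl⟩⟩
        invFun := fun t => ⟨fun i => (t.2 i).1, by
          have h : (fun i => s((t.2 i).1.1, (t.2 i).1.2)) = t.1.1 := funext fun i => (t.2 i).2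
          unfold Ace
          rw [h]
          refine ⟨fun i => ?_, t.1.2.2⟩
          have := t.1.2.1 i
          rw [← (t.2 i).2] at this
          simpa using this⟩
        left_inv := fun e => rfl
        right_inv := by
          rintro ⟨⟨σ, hσ⟩, g⟩
          obtain ⟨g', hg⟩ : ∃ g' : Fin m → Fin n × Fin n, ∀ i, g' i = (g i).1 :=
            ⟨fun i => (g i).1, fun i => rfl⟩
          have h : σ = (fun i => s((g' i).1, (g' i).2)) := funext fun i => by
            rw [hg]; exact (g i).2.symm
          subst h
          have hgg : g = fun i => ⟨g' i, rfl⟩ := funext fun i => Subtype.ext (hg i).symm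
          subst hgg
          rfl }
    rw [Nat.card_congr E, Nat.card_sigma]
    have : ∀ σ : S, Nat.card (∀ i, {x : Fin n × Fin n // s(x.1, x.2) = σ.1 i}) = 2 ^ m := by
      intro σ
      rw [Nat.card_pi]
      rw [prod_congr rfl (fun i _ => card_pairs _ (σ.2.1 i))]
      simp
    rw [sum_congr rfl (fun σ _ => this σ), sum_const, smul_eq_mul, card_univ,
      Nat.card_eq_fintype_card]
  have h2 : Nat.card S = forestCount n m * Nat.factorial m := by
    let H := {G : SimpleGraph (Fin n) // G.IsAcyclic ∧ Nat.card G.edgeSet = m}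
    have hes : ∀ σ : S, (SimpleGraph.fromEdgeSet (Set.range σ.1)).edgeSet = Set.range σ.1 := by
      intro σ
      rw [SimpleGraph.edgeSet_fromEdgeSet]
      ext z
      simp only [Set.mem_sdiff, Set.mem_range]
      constructor
      · exact fun h => h.1
      · rintro ⟨i, rfl⟩
        exact ⟨⟨i, rfl⟩, σ.2.1 i⟩
    let F : (Σ G : H, (Fin m ≃ G.1.edgeSet)) → S := fun t => ⟨fun i => (t.2 i).1, by
      have hr : Set.range (fun i => (t.2 i).1) = t.1.1.edgeSet := by
        ext z
        simp only [Set.mem_range]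
        constructor
        · rintro ⟨i, rfl⟩; exact (t.2 i).2
        · intro hz; exact ⟨t.2.symm ⟨z, hz⟩, by simp⟩
      refine ⟨fun i => SimpleGraph.not_isDiag_of_mem_edgeSet _ (t.2 i).2, fun i j hij => ?_, ?_⟩
      · exact t.2.injective (Subtype.ext hij)
      · rw [hr, SimpleGraph.fromEdgeSet_edgeSet]; exact t.1.2.1⟩
    have hF : Function.Bijective F := by
      constructor
      · rintro ⟨⟨G, hG⟩, f⟩ ⟨⟨G', hG'⟩, f'⟩ h
        have h' : ∀ i, (f i).1 = (f' i).1 := fun i => congrFun (congrArg Subtype.val h) i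
        have hGG : G = G' := by
          rw [← SimpleGraph.edgeSet_inj]
          ext z
          constructor
          · intro hz
            have := h' (f.symm ⟨z, hz⟩)
            rw [Equiv.apply_symm_apply] at this
            simp only at this
            rw [this]
            exact (f' _).2
          · intro hz
            have := h' (f'.symm ⟨z, hz⟩)
            rw [Equiv.apply_symm_apply] at this
            simp only at this
            rw [← this]
            exact (f _).2
        subst hGG
        have : f = f' := by ext1 i; exact Subtype.ext (h' i)
        rw [this]
      · intro σ
        let g : Fin m ≃ (SimpleGraph.fromEdgeSet (Set.range σ.1)).edgeSet :=
          (Equiv.ofInjective σ.1 σ.2.2.1).trans (Equiv.setCongr (hes σ).symm)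
        refine ⟨⟨⟨SimpleGraph.fromEdgeSet (Set.range σ.1), σ.2.2.2, ?_⟩, g⟩, ?_⟩
        · rw [← Nat.card_congr g, Nat.card_eq_fintype_card, Fintype.card_fin]
        · apply Subtype.ext
          funext i
          rfl
    rw [← Nat.card_congr (Equiv.ofBijective F hF), Nat.card_sigma]
    have : ∀ G : H, Nat.card (Fin m ≃ G.1.edgeSet) = Nat.factorial m := by
      intro G
      have hc := G.2.2
      rw [Nat.card_eq_fintype_card] at hc
      rw [Nat.card_eq_fintype_card, Fintype.card_equiv (Fintype.equivFinOfCardEq hc).symm, Fintype.card_fin]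
    simp only [this, sum_const, smul_eq_mul, card_univ]
    rw [forestCount, Nat.card_eq_fintype_card]
  rw [h1, h2]; ring

theorem card_trees (n : ℕ) (hn : 1 ≤ n) :
    Nat.card {t : Fin n → Option (Fin n) // IsRootedTree t} = n ^ (n - 1) := by
  classical
  haveI : Nonempty (Fin n) := ⟨⟨0, hn⟩⟩
  have h := card_Ct (n - 1) (fun _ : Fin n => none) (fun v => ⟨v, .base rfl⟩)
    (by simp [rts]; omega)
  rw [Fintype.card_fin] at h
  rw [← h, Nat.card_eq_fintype_card, Fintype.card_subtype]
  congr 1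
  ext p
  simp [Ct, tree_iff, Sub]

end Pk

/-- The probability that `m` i.i.d. uniform cars all park on a uniform rooted Cayley
tree `T_n`, multiplied by `(1 - m/n)`, equals the probability that the multigraph
`G(n,m)` (given by `m` independent uniform ordered pairs of endpoints) is acyclic;
equivalently, `PFroot(n,m) = n^(n-m-1)·m!·2^m·#F(n,m)`. -/
theorem stmt8 (n m : ℕ) (hn : 1 ≤ n) (hm : m ≤ n) :
    ((PF n m : ℚ) /
        ((Nat.card {t : Fin n → Option (Fin n) // IsRootedTree t} : ℚ) * (n : ℚ) ^ m) *
        (1 - (m : ℚ) / n) =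
      (Nat.card {e : Fin m → Fin n × Fin n //
          (∀ i, (e i).1 ≠ (e i).2) ∧
          Function.Injective (fun i => s((e i).1, (e i).2)) ∧
          (SimpleGraph.fromEdgeSet
            (Set.range fun i => s((e i).1, (e i).2))).IsAcyclic} : ℚ) /
        (n : ℚ) ^ (2 * m)) ∧
    PFroot n m = n ^ (n - m - 1) * Nat.factorial m * 2 ^ m * forestCount n m := by
  haveI : Nonempty (Fin n) := ⟨⟨0, hn⟩⟩
  change (_ = (Nat.card {e : Fin m → Fin n × Fin n // Pk.Ace e} : ℚ) / _) ∧ _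
  have hroot : PFroot n m = n ^ (n - m - 1) * Nat.card {e : Fin m → Fin n × Fin n // Pk.Ace e} := by
    rw [Pk.PFroot_eq, Pk.card_Ace]
    simp only [Finset.mul_sum, Pk.card_Rf_Fl, Fintype.card_fin, List.length_reverse,
      List.length_ofFn]
  have hPF : n * PFroot n m = (n - m) * PF n m := by
    rw [Pk.PFroot_eq, Pk.PF_eq]
    simp only [Finset.mul_sum]
    refine Finset.sum_congr rfl fun x _ => Finset.sum_congr rfl fun O _ => ?_
    have := Pk.card_Rf_Pf (List.ofFn x).reverse O
    simpa using this
  refine ⟨?_, ?_⟩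
  · rw [Pk.card_trees n hn]
    generalize Nat.card {e : Fin m → Fin n × Fin n // Pk.Ace e} = A at *
    rw [hroot] at hPF
    have hn0 : (n : ℚ) ≠ 0 := by positivity
    rcases hm.eq_or_lt with rfl | hlt
    · have hA : A = 0 := by
        rw [Nat.sub_self, zero_mul] at hPF
        simpa [show m ≠ 0 by omega] using hPF
      rw [hA, div_self hn0]
      simp
    · obtain ⟨d, rfl⟩ := Nat.exists_eq_add_of_lt hlt
      have e1 : m + d + 1 - m = d + 1 := by omega
      have e2 : m + d + 1 - m - 1 = d := by omega
      have e3 : m + d + 1 - 1 = m + d := by omega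
      rw [e2, e1] at hPF
      rw [e3, Nat.cast_pow]
      have hq : ((m + d + 1 : ℕ) : ℚ) * (((m + d + 1 : ℕ) : ℚ) ^ d * A) = ((d : ℚ) + 1) * PF (m + d + 1) m := by
        exact_mod_cast hPF
      have e4 : (1 : ℚ) - (m : ℚ) / ((m + d + 1 : ℕ) : ℚ) = ((d : ℚ) + 1) / ((m + d + 1 : ℕ) : ℚ) := by
        rw [eq_div_iff hn0, sub_mul, div_mul_cancel₀ _ hn0]
        push_cast; ring
      rw [e4]
      generalize ((m + d + 1 : ℕ) : ℚ) = N at *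
      rw [div_mul_div_comm, div_eq_div_iff (by positivity) (by positivity), mul_comm (PF _ _ : ℚ), ← hq]
      ring
  · rw [hroot, Pk.card_Ace']
    ring
end

section
/- The number of nearly parked trees of size n, i.e. PF_root(n, n-1), equals 2^{n-1} · (n-1)! · n^{n-2}. -/
open Classical in
/-- Occupied set of a partial forest. -/
noncomputable def psupp {n : ℕ} (f : Fin n → Option (Fin n)) : Finset (Fin n) :=
  Finset.univ.filter (fun v => f v ≠ none)

/-- Component size. -/
def psize {n : ℕ} (ρ : Fin n → Fin n) (r : Fin n) : ℕ :=
  (Finset.univ.filter (fun u => ρ u = r)).card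

/-- Set of roots. -/
def proots {n : ℕ} (ρ : Fin n → Fin n) : Finset (Fin n) :=
  Finset.univ.filter (fun u => ρ u = u)

structure PInv {n : ℕ} (f : Fin n → Option (Fin n)) (ρ : Fin n → Fin n) (d : Fin n → ℕ) : Prop where
  h1 : ∀ v, f v = none → ρ v = v
  h2 : ∀ v w, f v = some w → ρ v = ρ w
  h2' : ∀ v w, f v = some w → d w < d v
  h3 : ∀ v, f (ρ v) = none
  h4 : ∀ v, d v < psize ρ (ρ v)

def PQ {n : ℕ} (f p : Fin n → Option (Fin n)) (xs : List (Fin n)) : Prop :=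
  IsRootedTree p ∧ (∀ v w, f v = some w → p v = some w) ∧ ∃ occ : Finset (Fin n),
      parkAll p (psupp f) xs = some occ ∧ ∀ r, p r = none → r ∉ occ

open Classical in
noncomputable def PG {n : ℕ} (f : Fin n → Option (Fin n)) (m : ℕ) : ℕ :=
  ∑ p : Fin n → Option (Fin n), ∑ xs : Fin m → Fin n, if PQ f p (List.ofFn xs) then 1 else 0

lemma mem_psupp {n : ℕ} (f : Fin n → Option (Fin n)) (v : Fin n) : v ∈ psupp f ↔ f v ≠ none := by
  simp [psupp]

lemma PInv.rr {n : ℕ} {f : Fin n → Option (Fin n)} {ρ d} (h : PInv f ρ d) (v : Fin n) :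
    ρ (ρ v) = ρ v := h.h1 _ (h.h3 v)

lemma pstep_none {n : ℕ} (p : Fin n → Option (Fin n)) (k : ℕ) : (pstep p)^[k] none = none := by
  induction k with
  | zero => rfl
  | succ k ih => rw [Function.iterate_succ_apply]; exact ih

lemma drive_eq {n : ℕ} {f p : Fin n → Option (Fin n)} {ρ d} (h : PInv f ρ d)
    (hp : ∀ v w, f v = some w → p v = some w) (k : ℕ) (v : Fin n)
    (hk : (pstep p)^[k] (some v) = none) : drive p (psupp f) k v = some (ρ v) := by
  induction k generalizing v with
  | zero => simp at hk
  | succ k ih =>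
    rw [drive]
    rcases hf : f v with _ | w
    · have : v ∉ psupp f := by simp [mem_psupp, hf]
      rw [if_neg this, h.h1 v hf]
    · have : v ∈ psupp f := by simp [mem_psupp, hf]
      rw [if_pos this, hp v w hf, h.h2 v w hf]
      rw [Function.iterate_succ_apply] at hk
      have e : pstep p (some v) = some w := by simp [pstep, hp v w hf]
      rw [e] at hk
      exact ih w hk

lemma parkAll_mono {n : ℕ} (p : Fin n → Option (Fin n)) (xs : List (Fin n)) (o o' : Finset (Fin n))
    (h : parkAll p o xs = some o') : o ⊆ o' := by
  induction xs generalizing o with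
  | nil => simp [parkAll] at h; rw [h]
  | cons x xs ih =>
    rw [parkAll] at h
    rcases hd : drive p o n x with _ | s
    · simp [hd] at h
    · simp only [hd] at h
      exact (Finset.subset_insert _ _).trans (ih _ h)

lemma exists_rank {n : ℕ} (p : Fin n → Option (Fin n)) (h : IsRootedForest p) :
    ∃ e : Fin n → ℕ, ∀ v w, p v = some w → e w < e v := by
  classical
  refine ⟨fun v => Nat.find (p := fun k => (pstep p)^[k] (some v) = none) ⟨n, h v⟩, ?_⟩
  intro v w hvw
  have h1 := Nat.find_spec (p := fun k => (pstep p)^[k] (some v) = none) ⟨n, h v⟩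
  have e : pstep p (some v) = some w := by simp [pstep, hvw]
  show Nat.find (p := fun k => (pstep p)^[k] (some w) = none) ⟨n, h w⟩ <
    Nat.find (p := fun k => (pstep p)^[k] (some v) = none) ⟨n, h v⟩
  rcases hk : Nat.find (p := fun k => (pstep p)^[k] (some v) = none) ⟨n, h v⟩ with _ | k
  · rw [hk] at h1; simp at h1
  · rw [hk, Function.iterate_succ_apply, e] at h1
    exact Nat.lt_succ_of_le (Nat.find_min' _ h1)

lemma rank_root {n : ℕ} {f p : Fin n → Option (Fin n)} {ρ d} (h : PInv f ρ d)
    (hp : ∀ v w, f v = some w → p v = some w) (e : Fin n → ℕ)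
    (he : ∀ v w, p v = some w → e w < e v) (k : ℕ) (v : Fin n) (hk : d v ≤ k) :
    e (ρ v) ≤ e v := by
  induction k generalizing v with
  | zero =>
    rcases hf : f v with _ | w
    · rw [h.h1 v hf]
    · have := h.h2' v w hf; omega
  | succ k ih =>
    rcases hf : f v with _ | w
    · rw [h.h1 v hf]
    · have h1 := h.h2' v w hf
      have h2 := ih w (by omega)
      have h3 := he v w (hp v w hf)
      rw [h.h2 v w hf]; omega

lemma psupp_update {n : ℕ} (f : Fin n → Option (Fin n)) (r w : Fin n) :
    psupp (Function.update f r (some w)) = insert r (psupp f) := by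
  ext v
  rw [Finset.mem_insert, mem_psupp, mem_psupp]
  by_cases hv : v = r
  · subst hv; simp
  · simp [hv]

lemma PQ_cons {n : ℕ} {f p : Fin n → Option (Fin n)} {ρ d} (h : PInv f ρ d)
    (x : Fin n) (xs : List (Fin n)) :
    PQ f p (x :: xs) ↔ ∃ w, ρ w ≠ ρ x ∧ PQ (Function.update f (ρ x) (some w)) p xs := by
  constructor
  · rintro ⟨hT, hp, occ, ho, hr⟩
    have hd := drive_eq h hp n x (hT.1 x)
    rw [parkAll, hd] at ho
    simp only at ho
    have hm := parkAll_mono _ _ _ _ ho (Finset.mem_insert_self _ _)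
    rcases hw : p (ρ x) with _ | w
    · exact absurd hm (hr _ hw)
    · refine ⟨w, ?_, hT, ?_, occ, ?_, hr⟩
      · intro hh
        obtain ⟨e, he⟩ := exists_rank p hT.1
        have a1 := rank_root h hp e he _ w le_rfl
        have a2 := he _ _ hw
        rw [hh] at a1; omega
      · intro v u hv
        by_cases hvr : v = ρ x
        · subst hvr; simp at hv; rw [hw, hv]
        · rw [Function.update_of_ne hvr] at hv; exact hp _ _ hv
      · rw [psupp_update]; exact ho
  · rintro ⟨w, hw, hT, hp, occ, ho, hr⟩
    have hp' : ∀ v w, f v = some w → p v = some w := by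
      intro v u hv
      apply hp
      have : v ≠ ρ x := by
        rintro rfl; rw [h.h3] at hv; simp at hv
      rw [Function.update_of_ne this]; exact hv
    refine ⟨hT, hp', occ, ?_, hr⟩
    have hd := drive_eq h hp' n x (hT.1 x)
    rw [parkAll, hd]
    rw [psupp_update] at ho
    exact ho

lemma PG_succ {n : ℕ} {f : Fin n → Option (Fin n)} {ρ d} (h : PInv f ρ d) (m : ℕ) :
    PG f (m + 1) = ∑ x, ∑ w, if ρ w ≠ ρ x then PG (Function.update f (ρ x) (some w)) m else 0 := by
  classical
  have key : ∀ (p : Fin n → Option (Fin n)) x (xs : Fin m → Fin n),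
      (if PQ f p (x :: List.ofFn xs) then 1 else 0) =
      ∑ w, if ρ w ≠ ρ x then
        (if PQ (Function.update f (ρ x) (some w)) p (List.ofFn xs) then 1 else 0) else 0 := by
    intro p x xs
    rw [if_congr (PQ_cons h x _) rfl rfl]
    split_ifs with hq
    · obtain ⟨w, hw, hq⟩ := hq
      rw [Finset.sum_eq_single w]
      · rw [if_pos hw, if_pos hq]
      · intro u _ hu
        by_cases hu' : ρ u ≠ ρ x
        · rw [if_pos hu', if_neg]
          intro hq'
          have a := hq.2.1 (ρ x) w (by simp)
          have b := hq'.2.1 (ρ x) u (by simp)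
          rw [a] at b
          exact hu (Option.some.inj b).symm
        · rw [if_neg hu']
      · simp
    · symm
      apply Finset.sum_eq_zero
      intro w _
      push Not at hq
      by_cases hw : ρ w ≠ ρ x
      · rw [if_pos hw, if_neg (hq w hw)]
      · rw [if_neg hw]
  unfold PG
  have e1 : ∀ p : Fin n → Option (Fin n),
      (∑ xs : Fin (m+1) → Fin n, if PQ f p (List.ofFn xs) then 1 else 0) =
      ∑ x, ∑ w, ∑ xs : Fin m → Fin n, if ρ w ≠ ρ x then
        (if PQ (Function.update f (ρ x) (some w)) p (List.ofFn xs) then 1 else 0) else 0 := by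
    intro p
    rw [← (Fin.consEquiv (fun _ : Fin (m+1) => Fin n)).sum_comp, Fintype.sum_prod_type]
    refine Finset.sum_congr rfl fun x _ => ?_
    rw [Finset.sum_comm]
    refine Finset.sum_congr rfl fun xs _ => ?_
    rw [← key]
    simp [Fin.consEquiv, List.ofFn_succ]
  simp_rw [e1]
  rw [Finset.sum_comm]
  refine Finset.sum_congr rfl fun x _ => ?_
  rw [Finset.sum_comm]
  refine Finset.sum_congr rfl fun w _ => ?_
  split_ifs <;> simp

lemma psize_merge {n : ℕ} (ρ : Fin n → Fin n) (a b : Fin n) (hab : b ≠ a) :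
    psize (fun v => if ρ v = a then b else ρ v) b = psize ρ a + psize ρ b := by
  unfold psize
  rw [← Finset.card_union_of_disjoint]
  · congr 1
    ext v
    simp only [Finset.mem_filter, Finset.mem_univ, true_and, Finset.mem_union]
    split_ifs with h
    · simp [h]
    · simp [h]
  · rw [Finset.disjoint_left]
    intro v hv hv'
    simp only [Finset.mem_filter, Finset.mem_univ, true_and] at hv hv'
    exact hab (hv'.symm.trans hv)

lemma psize_other {n : ℕ} (ρ : Fin n → Fin n) (a b c : Fin n) (hb : c ≠ b) (ha : c ≠ a) :
    psize (fun v => if ρ v = a then b else ρ v) c = psize ρ c := by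
  unfold psize
  congr 1
  ext v
  simp only [Finset.mem_filter, Finset.mem_univ, true_and]
  split_ifs with h
  · rw [h]; exact ⟨fun e => absurd e.symm hb, fun e => absurd e.symm ha⟩
  · rfl

lemma PInv.merge {n : ℕ} {f : Fin n → Option (Fin n)} {ρ d} (h : PInv f ρ d) (x w : Fin n)
    (hw : ρ w ≠ ρ x) :
    PInv (Function.update f (ρ x) (some w)) (fun v => if ρ v = ρ x then ρ w else ρ v)
      (fun v => if ρ v = ρ x then d v + psize ρ (ρ w) else d v) := by
  have hx := h.rr x
  refine ⟨?_, ?_, ?_, ?_, ?_⟩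
  · intro v hv
    by_cases hvr : v = ρ x
    · subst hvr; simp at hv
    · rw [Function.update_of_ne hvr] at hv
      have := h.h1 v hv
      simp only [this, if_neg hvr]
  · intro v u hv
    by_cases hvr : v = ρ x
    · subst hvr; simp at hv; subst hv
      simp [hx, hw]
    · rw [Function.update_of_ne hvr] at hv
      simp only [h.h2 v u hv]
  · intro v u hv
    by_cases hvr : v = ρ x
    · subst hvr; simp at hv; subst hv
      simp only [hx, if_true, if_neg hw]
      have := h.h4 w
      omega
    · rw [Function.update_of_ne hvr] at hv
      have := h.h2' v u hv
      simp only [h.h2 v u hv]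
      split_ifs <;> omega
  · intro v
    split_ifs with hv
    · rw [Function.update_of_ne hw]; exact h.h3 w
    · rw [Function.update_of_ne hv]; exact h.h3 v
  · intro v
    have h4 := h.h4 v
    split_ifs with hv
    · rw [psize_merge _ _ _ hw]; rw [hv] at h4; omega
    · by_cases hvw : ρ v = ρ w
      · rw [hvw, psize_merge _ _ _ hw]; rw [hvw] at h4; omega
      · rw [psize_other _ _ _ _ hvw hv]; exact h4

lemma proots_merge {n : ℕ} {f : Fin n → Option (Fin n)} {ρ d} (h : PInv f ρ d) (x w : Fin n)
    (hw : ρ w ≠ ρ x) :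
    proots (fun v => if ρ v = ρ x then ρ w else ρ v) = (proots ρ).erase (ρ x) := by
  ext v
  simp only [proots, Finset.mem_filter, Finset.mem_univ, true_and, Finset.mem_erase]
  split_ifs with hv
  · constructor
    · rintro rfl; rw [h.rr] at hv; exact absurd hv hw
    · rintro ⟨a, b⟩; exact absurd (b.symm.trans hv) a
  · constructor
    · intro e; exact ⟨fun e' => hv (e.trans e'), e⟩
    · exact fun e => e.2

lemma proots_mem {n : ℕ} {f : Fin n → Option (Fin n)} {ρ d} (h : PInv f ρ d) (x : Fin n) :
    ρ x ∈ proots ρ := by simp [proots, h.rr]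

lemma sum_comp_root {n : ℕ} {f : Fin n → Option (Fin n)} {ρ d} (h : PInv f ρ d) (F : Fin n → ℕ) :
    ∑ x, F (ρ x) = ∑ a ∈ proots ρ, psize ρ a * F a := by
  rw [← Finset.sum_fiberwise_of_maps_to (g := ρ) (t := proots ρ) (fun x _ => proots_mem h x)]
  refine Finset.sum_congr rfl fun a _ => ?_
  rw [Finset.sum_congr rfl (g := fun _ => F a)]
  · simp [psize]
  · intro x hx
    simp only [Finset.mem_filter] at hx
    rw [hx.2]

lemma sum_size {n : ℕ} {f : Fin n → Option (Fin n)} {ρ d} (h : PInv f ρ d) :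
    ∑ a ∈ proots ρ, psize ρ a = n := by
  have := sum_comp_root h (fun _ => 1)
  simpa using this.symm

lemma sum_pairs {α : Type*} [DecidableEq α] (S : Finset α) (s : α → ℕ) (m : ℕ)
    (hS : S.card = m + 1) :
    ∑ a ∈ S, ∑ b ∈ S, (if b ≠ a then s a + s b else 0) = 2 * m * ∑ a ∈ S, s a := by
  have e1 : ∑ a ∈ S, ∑ b ∈ S, (if b ≠ a then s a else 0) = m * ∑ a ∈ S, s a := by
    rw [Finset.mul_sum]
    refine Finset.sum_congr rfl fun a ha => ?_
    rw [← Finset.sum_filter, Finset.filter_ne', Finset.sum_const, Finset.card_erase_of_mem ha, hS]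
    simp
  have e2 : ∑ a ∈ S, ∑ b ∈ S, (if b ≠ a then s b else 0) = m * ∑ a ∈ S, s a := by
    rw [Finset.sum_comm, ← e1]
    refine Finset.sum_congr rfl fun a ha => Finset.sum_congr rfl fun b hb => ?_
    simp only [ne_comm]
  have e3 : ∑ a ∈ S, ∑ b ∈ S, (if b ≠ a then s a + s b else 0) =
     ∑ a ∈ S, ∑ b ∈ S, (if b ≠ a then s a else 0) + ∑ a ∈ S, ∑ b ∈ S, (if b ≠ a then s b else 0) := by
    simp_rw [← Finset.sum_add_distrib]
    refine Finset.sum_congr rfl fun a ha => Finset.sum_congr rfl fun b hb => ?_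
    split_ifs <;> rfl
  rw [e3, e1, e2]; ring

lemma iter_none {n : ℕ} {f : Fin n → Option (Fin n)} {ρ d} (h : PInv f ρ d) (k : ℕ) (v : Fin n)
    (hk : d v < k) : (pstep f)^[k] (some v) = none := by
  induction k generalizing v with
  | zero => omega
  | succ k ih =>
    rw [Function.iterate_succ_apply]
    rcases hf : f v with _ | w
    · have e : pstep f (some v) = none := by simp [pstep, hf]
      rw [e, pstep_none]
    · have e : pstep f (some v) = some w := by simp [pstep, hf]
      rw [e]
      have := h.h2' v w hf
      exact ih w (by omega)

lemma PG_zero {n : ℕ} {f : Fin n → Option (Fin n)} {ρ d} (h : PInv f ρ d)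
    (hR : (proots ρ).card = 1) : PG f 0 = 1 := by
  classical
  obtain ⟨r, hr⟩ := Finset.card_eq_one.1 hR
  have hu : ∀ v, ρ v = r := fun v => by
    have := proots_mem h v
    rw [hr] at this; simpa using this
  have hfr : f r = none := by have := h.h3 r; rwa [hu r] at this
  have hur : ∀ v, f v = none → v = r := fun v hv => by rw [← h.h1 v hv, hu]
  have hT : IsRootedTree f := by
    refine ⟨fun v => ?_, r, hfr, hur⟩
    apply iter_none h
    refine (h.h4 v).trans_le ?_
    unfold psize
    exact (Finset.card_le_univ _).trans (by simp)
  have key : ∀ p, PQ f p [] ↔ p = f := by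
    intro p
    constructor
    · rintro ⟨hp, he, -⟩
      ext1 v
      rcases hf : f v with _ | w
      · obtain ⟨r', hr', -⟩ := hp.2
        have : f r' = none := by
          rcases hf' : f r' with _ | w
          · rfl
          · have := he _ _ hf'
            rw [hr'] at this; simp at this
        rw [hur v hf, ← hur r' this]; exact hr'
      · exact he v w hf
    · rintro rfl
      refine ⟨hT, fun _ _ e => e, psupp p, rfl, ?_⟩
      intro r hr
      simp [mem_psupp, hr]
  unfold PG
  simp [key]

lemma prod_merge {n : ℕ} {f : Fin n → Option (Fin n)} {ρ d} (h : PInv f ρ d) (x w : Fin n)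
    (hw : ρ w ≠ ρ x) :
    ∏ c ∈ proots (fun v => if ρ v = ρ x then ρ w else ρ v),
      psize (fun v => if ρ v = ρ x then ρ w else ρ v) c =
    (psize ρ (ρ x) + psize ρ (ρ w)) * ∏ c ∈ ((proots ρ).erase (ρ x)).erase (ρ w), psize ρ c := by
  rw [proots_merge h x w hw]
  rw [← Finset.mul_prod_erase _ _ (Finset.mem_erase.2 ⟨hw, proots_mem h w⟩), psize_merge _ _ _ hw]
  congr 1
  refine Finset.prod_congr rfl fun c hc => ?_
  simp only [Finset.mem_erase] at hc
  exact psize_other _ _ _ _ hc.1 hc.2.1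

lemma PG_main {n : ℕ} (m : ℕ) {f : Fin n → Option (Fin n)} {ρ d} (h : PInv f ρ d)
    (hR : (proots ρ).card = m + 1) :
    n * PG f m = 2 ^ m * m.factorial * n ^ m * ∏ c ∈ proots ρ, psize ρ c := by
  induction m generalizing f ρ d with
  | zero =>
    rw [PG_zero h hR]
    have := sum_size h
    obtain ⟨r, hr⟩ := Finset.card_eq_one.1 hR
    rw [hr] at this ⊢
    simp at this ⊢
    exact this.symm
  | succ m ih =>
    set K := 2 ^ m * m.factorial * n ^ m with hK
    set P := ∏ c ∈ proots ρ, psize ρ c with hP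
    let H : Fin n → Fin n → ℕ := fun a b => if b ≠ a then
      K * ((psize ρ a + psize ρ b) * ∏ c ∈ ((proots ρ).erase a).erase b, psize ρ c) else 0
    have e1 : n * PG f (m + 1) = ∑ x, ∑ w, H (ρ x) (ρ w) := by
      rw [PG_succ h, Finset.mul_sum]
      refine Finset.sum_congr rfl fun x _ => ?_
      rw [Finset.mul_sum]
      refine Finset.sum_congr rfl fun w _ => ?_
      by_cases hw : ρ w ≠ ρ x
      · simp only [H, if_pos hw]
        rw [ih (h.merge x w hw), prod_merge h x w hw]
        rw [proots_merge h x w hw, Finset.card_erase_of_mem (proots_mem h x), hR]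
        rfl
      · simp only [H, if_neg hw, mul_zero]
    have e2 : ∑ x, ∑ w, H (ρ x) (ρ w) =
        ∑ a ∈ proots ρ, ∑ b ∈ proots ρ, K * P * (if b ≠ a then psize ρ a + psize ρ b else 0) := by
      rw [sum_comp_root h (fun a => ∑ w, H a (ρ w))]
      refine Finset.sum_congr rfl fun a ha => ?_
      rw [sum_comp_root h (fun b => H a b), Finset.mul_sum]
      refine Finset.sum_congr rfl fun b hb => ?_
      simp only [H]
      split_ifs with hab
      · rw [hP, ← Finset.mul_prod_erase _ _ ha,
          ← Finset.mul_prod_erase _ _ (Finset.mem_erase.2 ⟨hab, hb⟩)]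
        ring
      · simp
    rw [e1, e2]
    simp_rw [← Finset.mul_sum]
    rw [sum_pairs _ _ _ hR, sum_size h, hK, Nat.factorial_succ]
    ring

/-- The number of nearly parked trees of size `n` is
`PFroot(n, n-1) = 2^(n-1) · (n-1)! · n^(n-2)`. -/
theorem stmt10 (n : ℕ) (hn : 1 ≤ n) :
    PFroot n (n - 1) = 2 ^ (n - 1) * Nat.factorial (n - 1) * n ^ (n - 2) := by
  classical
  have h : PInv (fun _ : Fin n => none) (fun v => v) (fun _ => 0) := by
    refine ⟨fun _ _ => rfl, ?_, ?_, fun _ => rfl, ?_⟩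
    · intro v w hv; simp at hv
    · intro v w hv; simp at hv
    · intro v; simp [psize, Finset.filter_eq']
  have hR : (proots (fun v : Fin n => v)).card = (n - 1) + 1 := by
    simp [proots]; omega
  have key := PG_main (n - 1) h hR
  have hprod : ∏ c ∈ proots (fun v : Fin n => v), psize (fun v : Fin n => v) c = 1 := by
    apply Finset.prod_eq_one
    intro c _
    simp [psize, Finset.filter_eq']
  have hPG : PFroot n (n - 1) = PG (fun _ : Fin n => none) (n - 1) := by
    have hs : psupp (fun _ : Fin n => (none : Option (Fin n))) = ∅ := by
      ext v; simp [mem_psupp]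
    unfold PFroot PG
    rw [Nat.card_eq_fintype_card, Fintype.card_subtype, Finset.card_filter, Fintype.sum_prod_type]
    simp only [PQ, hs]
    simp
  rw [hPG]
  rw [hprod, mul_one] at key
  rcases Nat.lt_or_ge 1 n with h1 | h1
  · obtain ⟨k, rfl⟩ : ∃ k, n = k + 2 := ⟨n - 2, by omega⟩
    apply Nat.eq_of_mul_eq_mul_left (show 0 < k + 2 by omega)
    rw [key]
    simp only [Nat.add_sub_cancel, show k + 2 - 1 = k + 1 by omega]
    ring
  · obtain rfl : n = 1 := by omega
    simpa using key
end

section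
/- The number SP(n,n) of strongly parked trees with n vertices and n cars equals (2n-2)!. -/
/-- A car arriving at `v` drives towards the root and parks at the first empty
vertex; returns the parking spot together with the set of (tail vertices of)
edges it drove through, or `none` if it exits through the root. -/
def driveFlux {n : ℕ} (p : Fin n → Option (Fin n)) (occ : Finset (Fin n)) :
    ℕ → Fin n → Option (Fin n × Finset (Fin n))
  | 0, _ => none
  | fuel + 1, v =>
      if v ∈ occ then
        (p v).bind fun w => (driveFlux p occ fuel w).map fun r => (r.1, insert v r.2)
      else some (v, ∅)

/-- Sequentially park the cars of the list, accumulating the set of edges with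
positive flux; returns `(occupied, used edges)` if every car parks. -/
def parkFlux {n : ℕ} (p : Fin n → Option (Fin n)) :
    Finset (Fin n) → Finset (Fin n) → List (Fin n) → Option (Finset (Fin n) × Finset (Fin n))
  | occ, used, [] => some (occ, used)
  | occ, used, v :: rest =>
      match driveFlux p occ n v with
      | none => none
      | some r => parkFlux p (insert r.1 occ) (used ∪ r.2) rest

/-- `SP n m`: number of pairs (rooted Cayley tree on `{1,…,n}`, sequence of `m` car
arrivals) such that all cars park and every edge of the tree has positive flux. -/
noncomputable def SP (n m : ℕ) : ℕ :=
  Nat.card {q : (Fin n → Option (Fin n)) × (Fin m → Fin n) //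
    IsRootedTree q.1 ∧ ∃ occ used : Finset (Fin n),
      parkFlux q.1 ∅ ∅ (List.ofFn q.2) = some (occ, used) ∧
      ∀ v, (q.1 v).isSome → v ∈ used}

set_option linter.unusedSectionVars false
set_option linter.unusedFintypeInType false

namespace SPk
open Relation

variable {V C : Type} [Fintype V] [Fintype C]

/-- reachability -/
def R (p : V → Option V) : V → V → Prop := ReflTransGen (fun a b => p a = some b)

lemma R.total {p : V → Option V} {a b c : V} (h1 : R p a b) (h2 : R p a c) : R p b c ∨ R p c b := by
  refine ReflTransGen.total_of_right_unique ?_ h1 h2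
  intro a b c h h'
  exact Option.some.inj (h.symm.trans h')

lemma R.refl' (p : V → Option V) (a : V) : R p a a := ReflTransGen.refl

lemma R.tr {p : V → Option V} {a b c : V} (h1 : R p a b) (h2 : R p b c) : R p a c :=
  ReflTransGen.trans h1 h2

lemma R.cases {p : V → Option V} {a b : V} (h : R p a b) : a = b ∨ ∃ c, p a = some c ∧ R p c b := by
  rcases ReflTransGen.cases_head h with h | ⟨c, h1, h2⟩
  · exact Or.inl h
  · exact Or.inr ⟨c, h1, h2⟩

lemma R.head' {p : V → Option V} {a b c : V} (h : p a = some b) (h2 : R p b c) : R p a c :=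
  ReflTransGen.head h h2

lemma R.of_none {p : V → Option V} {a b : V} (h : R p a b) (h0 : p a = none) : a = b := by
  rcases h.cases with h | ⟨c, h1, h2⟩
  · exact h
  · rw [h0] at h1; cases h1

lemma R.of_some {p : V → Option V} {a b c : V} (h : R p a c) (h0 : p a = some b) :
    a = c ∨ R p b c := by
  rcases h.cases with h | ⟨d, h1, h2⟩
  · exact Or.inl h
  · rw [h0] at h1; cases h1; exact Or.inr h2

lemma R.antisymm {p : V → Option V} {r x : V} (hr : p r = none) (hx : R p x r) :
    ∀ y, R p x y → R p y x → x = y := by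
  induction hx using ReflTransGen.head_induction_on with
  | refl => intro y h1 _; exact h1.of_none hr
  | head h hcr ih =>
    rename_i a c
    intro y h1 h2
    rcases h1.of_some h with h3 | h3
    · exact h3
    · have e1 := ih y h3 (h2.tr (R.head' h (R.refl' _ _)))
      subst e1
      exact (ih a h2 (R.head' h (R.refl' _ _))).symm

open Classical in
/-- descendants -/
noncomputable def dsc (p : V → Option V) (v : V) : Finset V := Finset.univ.filter (fun x => R p x v)

lemma mem_dsc {p : V → Option V} {v x : V} : x ∈ dsc p v ↔ R p x v := by simp [dsc]

/-- lemma on unions of descendant sets -/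
lemma union_dsc [DecidableEq V] (p : V → Option V) (g : V → ℤ) :
    ∀ (k : ℕ) (M : Finset V), M.card ≤ k → (∀ w ∈ M, 1 ≤ ∑ x ∈ dsc p w, g x) →
      (0 ≤ ∑ x ∈ M.biUnion (dsc p), g x) ∧ (M.Nonempty → 1 ≤ ∑ x ∈ M.biUnion (dsc p), g x) := by
  classical
  intro k
  induction k with
  | zero =>
    intro M hM _
    have : M = ∅ := by simpa using hM
    subst this
    simp
  | succ k ih =>
    intro M hM h
    rcases M.eq_empty_or_nonempty with rfl | hne
    · simp
    suffices hs : 1 ≤ ∑ x ∈ M.biUnion (dsc p), g x by exact ⟨by omega, fun _ => hs⟩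
    obtain ⟨w, hw, hmax⟩ := Finset.exists_max_image M (fun w => (dsc p w).card) hne
    have hmax' : ∀ x ∈ M, R p w x → R p x w := by
      intro x hx hwx
      have hsub : dsc p w ⊆ dsc p x := by
        intro y hy; rw [mem_dsc] at *; exact hy.tr hwx
      have := Finset.eq_of_subset_of_card_le hsub (hmax x hx)
      rw [← mem_dsc, this, mem_dsc]; exact R.refl' _ _
    have hM' : (M.filter (fun x => ¬ R p x w)).card ≤ k := by
      have : (M.filter (fun x => ¬ R p x w)).card < M.card := by
        apply Finset.card_lt_card
        rw [Finset.filter_ssubset]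
        exact ⟨w, hw, by simpa using R.refl' _ _⟩
      omega
    have hih := (ih _ hM' (fun w hw => h w (Finset.mem_filter.1 hw).1)).1
    have hU : M.biUnion (dsc p) = dsc p w ∪ (M.filter (fun x => ¬ R p x w)).biUnion (dsc p) := by
      ext y
      simp only [Finset.mem_biUnion, Finset.mem_union, Finset.mem_filter, mem_dsc]
      constructor
      · rintro ⟨a, ha, hy⟩
        by_cases haw : R p a w
        · exact Or.inl (hy.tr haw)
        · exact Or.inr ⟨a, ⟨ha, haw⟩, hy⟩
      · rintro (h | ⟨a, ⟨ha, haw⟩, hy⟩)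
        · exact ⟨w, hw, h⟩
        · exact ⟨a, ha, hy⟩
    have hd : Disjoint (dsc p w) ((M.filter (fun x => ¬ R p x w)).biUnion (dsc p)) := by
      rw [Finset.disjoint_left]
      intro y hy hy'
      simp only [Finset.mem_biUnion, Finset.mem_filter, mem_dsc] at hy hy'
      obtain ⟨a, ⟨ha, haw⟩, hya⟩ := hy'
      rcases hy.total hya with h1 | h1
      · exact haw (hmax' a ha h1)
      · exact haw h1
    rw [hU, Finset.sum_union hd]
    have := h w hw
    omega

open Classical in
/-- static flux -/
noncomputable def flux (p : V → Option V) (f : C → V) (D : Finset C) (v : V) : ℤ :=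
  ((D.filter (fun c => R p (f c) v)).card : ℤ) - (dsc p v).card

open Classical in
lemma flux_eq (p : V → Option V) (f : C → V) (D : Finset C) (v : V) :
    flux p f D v = ∑ x ∈ dsc p v, (((D.filter (fun c => f c = x)).card : ℤ) - 1) := by
  rw [Finset.sum_sub_distrib, flux]
  congr 1
  · rw [Finset.card_eq_sum_card_fiberwise (f := f) (t := dsc p v)]
    · push_cast
      apply Finset.sum_congr rfl
      intro x hx
      congr 2
      ext c
      simp only [Finset.mem_filter]
      rw [mem_dsc] at hx
      constructor
      · rintro ⟨⟨a, b⟩, c⟩; exact ⟨a, c⟩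
      · rintro ⟨a, rfl⟩; exact ⟨⟨a, hx⟩, rfl⟩
    · intro c hc
      simp at hc
      simpa [mem_dsc] using hc.2
  · simp

/-- tree on U -/
structure IsT (U : Finset V) (p : V → Option V) : Prop where
  cl : ∀ x y, p x = some y → x ∈ U ∧ y ∈ U
  root : ∃ r ∈ U, p r = none ∧ ∀ x ∈ U, R p x r

/-- strongly parked on U, D -/
structure IsSP (v0 : V) (U : Finset V) (D : Finset C) (t : (V → Option V) × (C → V)) : Prop where
  tree : IsT U t.1
  fD : ∀ c ∈ D, t.2 c ∈ U
  f0 : ∀ c ∉ D, t.2 c = v0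
  fl : ∀ v, t.1 v ≠ none → 1 ≤ flux t.1 t.2 D v

lemma IsT.antisymm {U : Finset V} {p : V → Option V} (h : IsT U p) {x y : V}
    (h1 : R p x y) (h2 : R p y x) : x = y := by
  obtain ⟨r, hr, hr0, hrr⟩ := h.root
  by_cases hx : x ∈ U
  · exact R.antisymm hr0 (hrr x hx) y h1 h2
  · rcases h1.cases with h | ⟨c, hc, _⟩
    · exact h
    · exact absurd (h.cl _ _ hc).1 hx

lemma IsT.mem_of_R {U : Finset V} {p : V → Option V} (h : IsT U p) {x y : V}
    (h1 : R p x y) (hy : y ∈ U) : x ∈ U := by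
  rcases h1.cases with rfl | ⟨c, hc, _⟩
  · exact hy
  · exact (h.cl _ _ hc).1

/-- the cut vertex -/
structure IsCut (d0 : C) (D : Finset C) (t : (V → Option V) × (C → V)) (u : V) : Prop where
  r : R t.1 (t.2 d0) u
  nr : t.1 u ≠ none
  one : flux t.1 t.2 D u = 1
  two : ∀ x, R t.1 (t.2 d0) x → R t.1 x u → x ≠ u → 2 ≤ flux t.1 t.2 D x

lemma IsCut.unique {d0 : C} {D : Finset C} {t : (V → Option V) × (C → V)} {u u' : V}
    (h : IsCut d0 D t u) (h' : IsCut d0 D t u') : u = u' := by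
  by_contra hne
  rcases h.r.total h'.r with h1 | h1
  · have := h'.two u h.r h1 hne
    have := h.one
    omega
  · have := h.two u' h'.r h1 (Ne.symm hne)
    have := h'.one
    omega

open Classical in
lemma exists_cut {v0 : V} {U : Finset V} {D : Finset C} {t : (V → Option V) × (C → V)}
    (h : IsSP v0 U D t) (hc : U.card = D.card) (h2 : 2 ≤ U.card) {d0 : C} (hd : d0 ∈ D) :
    ∃ u, IsCut d0 D t u := by
  obtain ⟨p, f⟩ := t
  obtain ⟨r, hr, hr0, hrr⟩ := h.tree.root
  have hT := h.tree
  have hfD := h.fD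
  have hfl := h.fl
  simp only at hr0 hrr hT hfD hfl
  set g : V → ℤ := fun x => ((D.filter (fun c => f c = x)).card : ℤ) - 1 with hg
  have hgU : ∑ x ∈ U, g x = 0 := by
    have : dsc p r = U := by
      ext x; rw [mem_dsc]; exact ⟨fun h => hT.mem_of_R h hr, hrr x⟩
    rw [← this, hg, ← flux_eq, flux, this]
    have : D.filter (fun c => R p (f c) r) = D := by
      apply Finset.filter_true_of_mem
      intro c hc; exact hrr _ (hfD c hc)
    rw [this]; omega
  have hnr : ∀ x ∈ U, x ≠ r → p x ≠ none := fun x hx hxr h0 => hxr ((hrr x hx).of_none h0)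
  -- down-closed sets
  have key : ∀ W : Finset V, W ⊆ U → r ∉ W → (∀ x y, y ∈ W → R p x y → x ∈ W) → W.Nonempty →
      1 ≤ ∑ x ∈ W, g x := by
    intro W hWU hrW hcl hne
    have := (union_dsc p g W.card W le_rfl ?_).2 hne
    · have e : W.biUnion (dsc p) = W := by
        ext x
        simp only [Finset.mem_biUnion, mem_dsc]
        exact ⟨fun ⟨a, ha, hx⟩ => hcl _ _ ha hx, fun hx => ⟨x, hx, R.refl' _ _⟩⟩
      rwa [e] at this
    · intro w hw
      rw [hg, ← flux_eq]
      exact hfl w (hnr w (hWU hw) (by rintro rfl; exact hrW hw))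
  have hrR : ∀ y, R p r y → y = r := fun y hy => (hy.of_none hr0).symm
  have hW := key (U.erase r) (Finset.erase_subset _ _) (by simp) (by
      intro x y hy hxy
      rw [Finset.mem_erase] at *
      refine ⟨?_, hT.mem_of_R hxy hy.2⟩
      rintro rfl
      exact hy.1 (hrR _ hxy)) (by
      rw [← Finset.card_pos, Finset.card_erase_of_mem hr]; omega)
  have hsplit := Finset.add_sum_erase U g hr
  have hgr : g r = -1 ∧ ∑ x ∈ U.erase r, g x = 1 := by
    have : -1 ≤ g r := by simp only [hg]; omega
    omega
  have hxr : f d0 ≠ r := by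
    intro he
    have : 0 < (D.filter (fun c => f c = r)).card := Finset.card_pos.2 ⟨d0, by simp [hd, he]⟩
    have := hgr.1
    simp only [hg] at this
    omega
  -- child of the root
  obtain ⟨c, hc1, hc2⟩ : ∃ c, R p (f d0) c ∧ p c = some r := by
    have := hrr _ (hfD _ hd)
    rcases ReflTransGen.cases_tail this with h | ⟨c, h1, h2⟩
    · exact absurd h.symm hxr
    · exact ⟨c, h1, h2⟩
  have hcU := (hT.cl _ _ hc2).1
  have hcr : c ≠ r := by rintro rfl; rw [hr0] at hc2; cases hc2
  have hcf : flux p f D c = 1 := by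
    have h1 := hfl c (by rw [hc2]; simp)
    have hs : dsc p c ⊆ U.erase r := by
      intro x hx
      rw [mem_dsc] at hx
      rw [Finset.mem_erase]
      refine ⟨?_, hT.mem_of_R hx hcU⟩
      rintro rfl
      exact hcr (hrR _ hx)
    have h3 := Finset.sum_sdiff (f := g) hs
    rw [flux_eq] at h1 ⊢
    rcases (U.erase r \ dsc p c).eq_empty_or_nonempty with he | hne
    · rw [he, Finset.sum_empty, hgr.2] at h3
      simp only [hg] at h3
      omega
    · have := key _ (Finset.sdiff_subset.trans (Finset.erase_subset _ _)) (by simp) (by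
        intro x y hy hxy
        simp only [Finset.mem_sdiff, Finset.mem_erase, mem_dsc] at *
        refine ⟨⟨?_, hT.mem_of_R hxy hy.1.2⟩, ?_⟩
        · rintro rfl
          exact hy.1.1 (hrR _ hxy)
        · intro hxc
          rcases hxc.total hxy with h | h
          · rcases h.of_some hc2 with h | h
            · exact hy.2 (h ▸ R.refl' _ _)
            · exact hy.1.1 (hrR _ h)
          · exact hy.2 h) hne
      rw [hgr.2] at h3
      simp only [hg] at h3 this
      omega
  obtain ⟨u, hu, hmin⟩ := Finset.exists_min_image
    (Finset.univ.filter (fun u => R p (f d0) u ∧ p u ≠ none ∧ flux p f D u = 1))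
    (fun u => (dsc p u).card) ⟨c, by simp [hc1, hc2, hcf]⟩
  simp only [Finset.mem_filter, Finset.mem_univ, true_and] at hu hmin
  refine ⟨u, hu.1, hu.2.1, hu.2.2, ?_⟩
  intro x hx hxu hne
  simp only at hx hxu ⊢
  have hx0 : p x ≠ none := fun h0 => hne (hxu.of_none h0)
  have h1 := hfl x hx0
  by_contra hlt
  have h3 := hmin x ⟨hx, hx0, by omega⟩
  have hs : dsc p x ⊆ dsc p u := by
    intro y hy; rw [mem_dsc] at *; exact hy.tr hxu
  have := Finset.eq_of_subset_of_card_le hs h3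
  have : R p u x := by rw [← mem_dsc, this, mem_dsc]; exact R.refl' _ _
  exact hne (hT.antisymm hxu this)

end SPk

namespace SPk
open Relation

variable {V C : Type} [Fintype V] [Fintype C]

/-- p is glued from p1 and p2 along u → w -/
structure Glue (U1 U2 : Finset V) (p1 p2 p : V → Option V) (u w : V) : Prop where
  disj : ∀ x ∈ U1, x ∉ U2
  hu : u ∈ U1
  hw : w ∈ U2
  e1 : ∀ x ∈ U1, x ≠ u → p x = p1 x
  eu : p u = some w
  e1u : p1 u = none
  e2 : ∀ x ∈ U2, p x = p2 x
  e0 : ∀ x, p x ≠ none → x ∈ U1 ∨ x ∈ U2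
  c1 : ∀ x y, p1 x = some y → x ∈ U1 ∧ y ∈ U1
  c2 : ∀ x y, p2 x = some y → x ∈ U2 ∧ y ∈ U2
  r1 : ∀ x ∈ U1, R p1 x u

section
variable {U1 U2 : Finset V} {p1 p2 p : V → Option V} {u w : V}

lemma R.mem {U : Finset V} {p : V → Option V} (h : ∀ x y, p x = some y → x ∈ U ∧ y ∈ U) {x y : V}
    (h1 : R p x y) (hy : y ∈ U) : x ∈ U := by
  rcases h1.cases with rfl | ⟨c, hc, _⟩
  · exact hy
  · exact (h _ _ hc).1

lemma R.mono {p q : V → Option V} (h : ∀ x y, p x = some y → q x = some y) {x y : V}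
    (h1 : R p x y) : R q x y := ReflTransGen.mono (fun a b => h a b) _ _ h1

lemma Glue.R1 (G : Glue U1 U2 p1 p2 p u w) {y : V} (hy : y ∈ U1) (x : V) :
    R p x y ↔ R p1 x y := by
  constructor
  · intro h
    induction h using ReflTransGen.head_induction_on with
    | refl => exact R.refl' _ _
    | head h hcr ih =>
      rename_i x z
      have hz := R.mem G.c1 ih hy
      rcases G.e0 x (by rw [h]; simp) with hx | hx
      · by_cases hxu : x = u
        · subst hxu
          rw [G.eu] at h
          cases h
          exact absurd G.hw (G.disj _ hz)
        · exact R.head' ((G.e1 x hx hxu).symm.trans h) ih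
      · rw [G.e2 x hx] at h
        exact absurd (G.c2 _ _ h).2 (G.disj _ hz)
  · apply R.mono
    intro a b hab
    rw [G.e1 a (G.c1 _ _ hab).1, hab]
    rintro rfl
    rw [G.e1u] at hab; cases hab

lemma Glue.R2 (G : Glue U1 U2 p1 p2 p u w) {y : V} (hy : y ∈ U2) (x : V) :
    R p x y ↔ R p2 x y ∨ (x ∈ U1 ∧ R p2 w y) := by
  have hm : ∀ x y, R p2 x y → R p x y := by
    intro x y
    apply R.mono
    intro a b hab
    rw [G.e2 a (G.c2 _ _ hab).1, hab]
  constructor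
  · intro h
    induction h using ReflTransGen.head_induction_on with
    | refl => exact Or.inl (R.refl' _ _)
    | head h hcr ih =>
      rename_i x z
      rcases G.e0 x (by rw [h]; simp) with hx | hx
      · right
        refine ⟨hx, ?_⟩
        by_cases hxu : x = u
        · subst hxu
          rw [G.eu] at h
          cases h
          rcases ih with ih | ih
          · exact ih
          · exact ih.2
        · rw [G.e1 x hx hxu] at h
          rcases ih with ih | ih
          · exact absurd (R.mem G.c2 ih hy) (G.disj _ (G.c1 _ _ h).2)
          · exact ih.2
      · rw [G.e2 x hx] at h
        rcases ih with ih | ih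
        · exact Or.inl (R.head' h ih)
        · exact absurd (G.c2 _ _ h).2 (G.disj _ ih.1)
  · rintro (h | ⟨h1, h2⟩)
    · exact hm _ _ h
    · exact ((G.R1 G.hu x).2 (G.r1 x h1)).tr (R.head' G.eu (hm _ _ h2))

lemma Glue.R2' (G : Glue U1 U2 p1 p2 p u w) {x y : V} (hx : x ∈ U2) (hy : y ∈ U2) :
    R p x y ↔ R p2 x y := by
  rw [G.R2 hy]
  constructor
  · rintro (h | h)
    · exact h
    · exact absurd hx (G.disj _ h.1)
  · exact Or.inl

lemma Glue.R2'' (G : Glue U1 U2 p1 p2 p u w) {x y : V} (hx : x ∈ U1) (hy : y ∈ U2) :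
    R p x y ↔ R p2 w y := by
  rw [G.R2 hy]
  constructor
  · rintro (h | h)
    · exact absurd (R.mem G.c2 h hy) (G.disj _ hx)
    · exact h.2
  · exact fun h => Or.inr ⟨hx, h⟩

/-- gluing of cars -/
structure GlueF (U1 U2 : Finset V) (D1 D2 : Finset C) (f1 f2 f : C → V) (d0 : C) (w : V) :
    Prop where
  dd : ∀ x ∈ D1, x ∉ D2
  h0 : d0 ∈ D2
  f0 : f d0 ∈ U1
  f20 : f2 d0 = w
  e1 : ∀ c ∈ D1, f c = f1 c
  m1 : ∀ c ∈ D1, f1 c ∈ U1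
  e2 : ∀ c ∈ D2, c ≠ d0 → f c = f2 c
  m2 : ∀ c ∈ D2, c ≠ d0 → f2 c ∈ U2
  cd : U1.card = D1.card

variable {D1 D2 : Finset C} {f1 f2 f : C → V} {d0 : C}

open Classical in
lemma Glue.flux1 (G : Glue U1 U2 p1 p2 p u w) (F : GlueF U1 U2 D1 D2 f1 f2 f d0 w) {y : V}
    (hy : y ∈ U1) : flux p f (D1 ∪ D2) y = flux p1 f1 D1 y + if R p1 (f d0) y then 1 else 0 := by
  have hd : dsc p y = dsc p1 y := by
    ext x; rw [mem_dsc, mem_dsc, G.R1 hy]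
  have hc : (D1 ∪ D2).filter (fun c => R p (f c) y) =
      (D1.filter (fun c => R p1 (f1 c) y)) ∪ (if R p1 (f d0) y then {d0} else ∅) := by
    ext c
    simp only [Finset.mem_filter, Finset.mem_union, G.R1 hy]
    by_cases hc1 : c ∈ D1
    · have hne : c ≠ d0 := by rintro rfl; exact F.dd _ hc1 F.h0
      rw [F.e1 c hc1]
      split_ifs <;> simp [hc1, hne]
    · by_cases hc0 : c = d0
      · subst hc0
        split_ifs with h <;> simp [hc1, F.h0, h]
      · by_cases hc2 : c ∈ D2
        · have : ¬ R p1 (f c) y := by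
            intro h
            rw [F.e2 c hc2 hc0] at h
            exact G.disj _ (R.mem G.c1 h hy) (F.m2 c hc2 hc0)
          split_ifs <;> simp [hc1, this, hc0]
        · split_ifs <;> simp [hc1, hc2, hc0]
  rw [flux, flux, hd, hc, Finset.card_union_of_disjoint]
  · split_ifs <;> simp <;> ring
  · rw [Finset.disjoint_left]
    intro c hcc hc'
    simp only [Finset.mem_filter] at hcc
    split_ifs at hc' with h
    · rw [Finset.mem_singleton] at hc'
      exact F.dd _ hcc.1 (hc' ▸ F.h0)
    · simp at hc'

open Classical in
lemma Glue.flux2 (G : Glue U1 U2 p1 p2 p u w) (F : GlueF U1 U2 D1 D2 f1 f2 f d0 w) {y : V}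
    (hy : y ∈ U2) : flux p f (D1 ∪ D2) y = flux p2 f2 D2 y := by
  have hd : dsc p y = dsc p2 y ∪ (if R p2 w y then U1 else ∅) := by
    ext x; rw [mem_dsc, Finset.mem_union, mem_dsc, G.R2 hy]
    split_ifs with h <;> simp [h]
  have hc : (D1 ∪ D2).filter (fun c => R p (f c) y) =
      (D2.filter (fun c => R p2 (f2 c) y)) ∪ (if R p2 w y then D1 else ∅) := by
    ext c
    simp only [Finset.mem_filter, Finset.mem_union]
    by_cases hc1 : c ∈ D1
    · have := F.dd _ hc1
      rw [F.e1 c hc1, G.R2'' (F.m1 c hc1) hy]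
      split_ifs with h <;> simp [hc1, this, h]
    · by_cases hc0 : c = d0
      · subst hc0
        rw [G.R2'' F.f0 hy, F.f20]
        split_ifs with h <;> simp [hc1, F.h0, h]
      · by_cases hc2 : c ∈ D2
        · rw [F.e2 c hc2 hc0, G.R2' (F.m2 c hc2 hc0) hy]
          split_ifs <;> simp [hc1, hc2]
        · split_ifs <;> simp [hc1, hc2]
  rw [flux, flux, hd, hc, Finset.card_union_of_disjoint, Finset.card_union_of_disjoint]
  · split_ifs <;> simp [F.cd]
  · rw [Finset.disjoint_left]
    intro x hx hx'
    split_ifs at hx' with h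
    · exact G.disj x hx' (R.mem G.c2 (mem_dsc.1 hx) hy)
    · simp at hx'
  · rw [Finset.disjoint_left]
    intro x hx hx'
    split_ifs at hx' with h
    · exact F.dd x hx' (Finset.mem_filter.1 hx).1
    · simp at hx'

open Classical in
lemma glue_SP (v0 : V) (G : Glue U1 U2 p1 p2 p u w) (F : GlueF U1 U2 D1 D2 f1 f2 f d0 w)
    (hf0 : ∀ c, c ∉ D1 ∪ D2 → f c = v0)
    (h1 : IsSP v0 U1 D1 (p1, f1)) (h2 : IsSP v0 U2 D2 (p2, f2)) :
    IsSP v0 (U1 ∪ U2) (D1 ∪ D2) (p, f) ∧ IsCut d0 (D1 ∪ D2) (p, f) u ∧ dsc p u = U1 := by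
  have hfu : flux p1 f1 D1 u = 0 := by
    have e1 : dsc p1 u = U1 := by
      ext x; rw [mem_dsc]; exact ⟨fun h => R.mem G.c1 h G.hu, G.r1 x⟩
    have e2 : D1.filter (fun c => R p1 (f1 c) u) = D1 :=
      Finset.filter_true_of_mem (fun c hc => G.r1 _ (F.m1 c hc))
    rw [flux, e1, e2, F.cd, sub_self]
  have hfu1 : flux p f (D1 ∪ D2) u = 1 := by
    rw [G.flux1 F G.hu, hfu, if_pos (G.r1 _ F.f0)]; rfl
  refine ⟨⟨⟨?_, ?_⟩, ?_, hf0, ?_⟩, ⟨?_, ?_, hfu1, ?_⟩, ?_⟩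
  · intro x y hxy
    simp only [Finset.mem_union] at *
    rcases G.e0 x (by rw [hxy]; simp) with hx | hx
    · by_cases hxu : x = u
      · subst hxu
        simp only [G.eu] at hxy; cases hxy
        exact ⟨Or.inl G.hu, Or.inr G.hw⟩
      · simp only [G.e1 x hx hxu] at hxy
        exact ⟨Or.inl hx, Or.inl (G.c1 _ _ hxy).2⟩
    · simp only [G.e2 x hx] at hxy
      exact ⟨Or.inr hx, Or.inr (G.c2 _ _ hxy).2⟩
  · obtain ⟨r, hr, hr0, hrr⟩ := h2.tree.root
    simp only at hr0 hrr
    refine ⟨r, Finset.mem_union_right _ hr, ?_, ?_⟩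
    · simp only [G.e2 r hr, hr0]
    · intro x hx
      simp only [G.R2 hr]
      rcases Finset.mem_union.1 hx with hx | hx
      · exact Or.inr ⟨hx, hrr _ G.hw⟩
      · exact Or.inl (hrr _ hx)
  · intro c hc
    simp only
    by_cases hc1 : c ∈ D1
    · rw [F.e1 c hc1]; exact Finset.mem_union_left _ (F.m1 c hc1)
    · by_cases hc0 : c = d0
      · subst hc0; exact Finset.mem_union_left _ F.f0
      · have hc2 : c ∈ D2 := by simpa [hc1] using hc
        rw [F.e2 c hc2 hc0]; exact Finset.mem_union_right _ (F.m2 c hc2 hc0)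
  · intro y hy
    simp only at hy ⊢
    rcases G.e0 y hy with hx | hx
    · by_cases hxu : y = u
      · subst hxu; rw [hfu1]
      · rw [G.flux1 F hx]
        have := h1.fl y (by simp only; rwa [← G.e1 y hx hxu])
        simp only at this
        split_ifs <;> omega
    · rw [G.flux2 F hx]
      exact h2.fl y (by simp only; rwa [← G.e2 y hx])
  · exact (G.R1 G.hu _).2 (G.r1 _ F.f0)
  · simp [G.eu]
  · intro x hx hxu hne
    simp only at hx hxu ⊢
    have hxU : x ∈ U1 := R.mem G.c1 ((G.R1 G.hu _).1 hxu) G.hu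
    rw [G.flux1 F hxU, if_pos ((G.R1 hxU _).1 hx)]
    have := h1.fl x (fun h0 => hne (((G.R1 G.hu _).1 hxu).of_none h0))
    simp only at this
    omega
  · ext x
    rw [mem_dsc, G.R1 G.hu]; exact ⟨fun h => R.mem G.c1 h G.hu, G.r1 x⟩

open Classical in
lemma unglue_SP (v0 : V) (G : Glue U1 U2 p1 p2 p u w) (F : GlueF U1 U2 D1 D2 f1 f2 f d0 w)
    (hf1 : ∀ c, c ∉ D1 → f1 c = v0) (hf2 : ∀ c, c ∉ D2 → f2 c = v0)
    (h : IsSP v0 (U1 ∪ U2) (D1 ∪ D2) (p, f)) (hcut : IsCut d0 (D1 ∪ D2) (p, f) u) :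
    IsSP v0 U1 D1 (p1, f1) ∧ IsSP v0 U2 D2 (p2, f2) := by
  refine ⟨⟨⟨G.c1, u, G.hu, G.e1u, G.r1⟩, F.m1, hf1, ?_⟩, ⟨⟨G.c2, ?_⟩, ?_, hf2, ?_⟩⟩
  · intro y hy
    simp only at hy ⊢
    have hyU : y ∈ U1 := by
      obtain ⟨z, hz⟩ := Option.ne_none_iff_exists'.1 hy
      exact (G.c1 _ _ hz).1
    have hyu : y ≠ u := by rintro rfl; exact hy G.e1u
    have hf := G.flux1 F hyU
    by_cases hR : R p1 (f d0) y
    · rw [if_pos hR] at hf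
      have := hcut.two y ((G.R1 hyU _).2 hR) ((G.R1 G.hu _).2 (G.r1 _ hyU)) hyu
      simp only at this
      omega
    · rw [if_neg hR] at hf
      have := h.fl y (by simp only; rwa [G.e1 y hyU hyu])
      simp only at this
      omega
  · obtain ⟨r, hr, hr0, hrr⟩ := h.tree.root
    simp only at hr0 hrr
    have hr2 : r ∈ U2 := by
      rcases Finset.mem_union.1 hr with hr1 | hr2
      · have := ((G.R1 G.hu _).2 (G.r1 _ hr1)).of_none hr0
        subst this
        rw [G.eu] at hr0; cases hr0
      · exact hr2
    refine ⟨r, hr2, ?_, ?_⟩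
    · simp only; rw [← G.e2 r hr2, hr0]
    · intro x hx
      exact (G.R2' hx hr2).1 (hrr x (Finset.mem_union_right _ hx))
  · intro c hc
    simp only
    by_cases hc0 : c = d0
    · subst hc0; rw [F.f20]; exact G.hw
    · exact F.m2 c hc hc0
  · intro y hy
    simp only at hy ⊢
    have hyU : y ∈ U2 := by
      obtain ⟨z, hz⟩ := Option.ne_none_iff_exists'.1 hy
      exact (G.c2 _ _ hz).1
    rw [← G.flux2 F hyU]
    exact h.fl y (by simp only; rwa [G.e2 y hyU])

end
end SPk

namespace SPk
open Relation

variable {V C : Type} [Fintype V] [Fintype C]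

open Classical in
/-- all strongly parked structures on U, D -/
noncomputable def TT (v0 : V) (U : Finset V) (D : Finset C) : Finset ((V → Option V) × (C → V)) :=
  Finset.univ.filter (IsSP v0 U D)

lemma mem_TT {v0 : V} {U : Finset V} {D : Finset C} {t : (V → Option V) × (C → V)} :
    t ∈ TT v0 U D ↔ IsSP v0 U D t := by simp [TT]

/-- decomposition data -/
abbrev Dat (V C : Type) : Type :=
  (_ : Finset V × Finset C) × (((V → Option V) × (C → V)) × V × ((V → Option V) × (C → V)))

open Classical in
/-- index set -/
noncomputable def Idx (U : Finset V) (D : Finset C) (d0 : C) : Finset (Finset V × Finset C) :=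
  (U.powerset ×ˢ (D.erase d0).powerset).filter (fun i => i.1.card = i.2.card)

open Classical in
/-- decompositions -/
noncomputable def Dec (v0 : V) (U : Finset V) (D : Finset C) (d0 : C) : Finset (Dat V C) :=
  (Idx U D d0).sigma (fun i => TT v0 i.1 i.2 ×ˢ i.1 ×ˢ TT v0 (U \ i.1) (D \ i.2))

open Classical in
/-- glue -/
noncomputable def glue (d0 : C) (x : Dat V C) : (V → Option V) × (C → V) :=
  (fun a => if a ∈ x.1.1 then some ((x.2.1.1 a).getD (x.2.2.2.2 d0)) else x.2.2.2.1 a,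
   fun c => if c = d0 then x.2.2.1 else if c ∈ x.1.2 then x.2.1.2 c else x.2.2.2.2 c)

open Classical in
/-- unglue -/
noncomputable def unglue (v0 : V) (D : Finset C) (d0 : C) (t : (V → Option V) × (C → V)) (u : V) :
    Dat V C :=
  ⟨(dsc t.1 u, D.filter (fun c => c ≠ d0 ∧ R t.1 (t.2 c) u)),
   (fun x => if x ∈ dsc t.1 u ∧ x ≠ u then t.1 x else none,
    fun c => if c ∈ D.filter (fun c => c ≠ d0 ∧ R t.1 (t.2 c) u) then t.2 c else v0),
   t.2 d0,
   (fun x => if x ∈ dsc t.1 u then none else t.1 x,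
    fun c => if c = d0 then (t.1 u).getD v0 else
      if c ∈ D.filter (fun c => c ≠ d0 ∧ R t.1 (t.2 c) u) then v0 else t.2 c)⟩

open Classical in
lemma glue_spec {v0 : V} {U : Finset V} {D : Finset C} {d0 : C} (hd : d0 ∈ D) {x : Dat V C}
    (hx : x ∈ Dec v0 U D d0) :
    glue d0 x ∈ TT v0 U D ∧ ∃ u, IsCut d0 D (glue d0 x) u ∧ unglue v0 D d0 (glue d0 x) u = x := by
  obtain ⟨⟨U1, D1⟩, ⟨p1, f1⟩, v, ⟨p2, f2⟩⟩ := x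
  simp only [Dec, Idx, Finset.mem_sigma, Finset.mem_filter, Finset.mem_product,
    Finset.mem_powerset, mem_TT] at hx
  obtain ⟨⟨⟨hU, hD⟩, hcd⟩, h1, hv, h2⟩ := hx
  obtain ⟨u, hu, hu0, hur⟩ := h1.tree.root
  simp only at hu0 hur
  have hd1 : d0 ∉ D1 := fun h => by simpa using hD h
  have hD' : D1 ⊆ D := hD.trans (Finset.erase_subset _ _)
  set p : V → Option V := fun a => if a ∈ U1 then some ((p1 a).getD (f2 d0)) else p2 a with hp
  set f : C → V := fun c => if c = d0 then v else if c ∈ D1 then f1 c else f2 c with hf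
  have ht : glue d0 (⟨(U1, D1), (p1, f1), v, (p2, f2)⟩ : Dat V C) = (p, f) := rfl
  have hne : ∀ x ∈ U1, x ≠ u → p1 x ≠ none := fun x hx hxu h0 => hxu ((hur x hx).of_none h0)
  have G : Glue U1 (U \ U1) p1 p2 p u (f2 d0) := by
    refine ⟨by intro x hx; simp [hx], hu, h2.fD d0 (by simp [hd, hd1]), ?_, ?_, hu0, ?_, ?_,
      h1.tree.cl, h2.tree.cl, hur⟩
    · intro x hx hxu
      obtain ⟨z, hz⟩ := Option.ne_none_iff_exists'.1 (hne x hx hxu)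
      simp [hp, hx, hz]
    · simp [hp, hu, hu0]
    · intro x hx
      have := (Finset.mem_sdiff.1 hx).2
      simp [hp, this]
    · intro x hx
      by_cases hx1 : x ∈ U1
      · exact Or.inl hx1
      · simp only [hp, hx1, if_false] at hx
        obtain ⟨z, hz⟩ := Option.ne_none_iff_exists'.1 hx
        exact Or.inr (h2.tree.cl _ _ hz).1
  have F : GlueF U1 (U \ U1) D1 (D \ D1) f1 f2 f d0 (f2 d0) := by
    refine ⟨by intro x hx; simp [hx], by simp [hd, hd1], by simp [hf, hv], rfl, ?_, h1.fD, ?_,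
      fun c hc _ => h2.fD c hc, hcd⟩
    · intro c hc
      have : c ≠ d0 := by rintro rfl; exact hd1 hc
      simp [hf, this, hc]
    · intro c hc hc0
      have := (Finset.mem_sdiff.1 hc).2
      simp [hf, this, hc0]
  have eU : U1 ∪ (U \ U1) = U := Finset.union_sdiff_of_subset hU
  have eD : D1 ∪ (D \ D1) = D := Finset.union_sdiff_of_subset hD'
  have key := glue_SP v0 G F (by
    intro c hc
    rw [eD] at hc
    have h3 : c ≠ d0 := by rintro rfl; exact hc hd
    have h4 : c ∉ D1 := fun h => hc (hD' h)
    simp only [hf, h3, h4, if_false]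
    exact h2.f0 c (fun h => hc (Finset.mem_sdiff.1 h).1)) h1 h2
  rw [eU, eD] at key
  obtain ⟨k1, k2, k3⟩ := key
  rw [ht, mem_TT]
  refine ⟨k1, u, k2, ?_⟩
  have eDD : D.filter (fun c => c ≠ d0 ∧ R p (f c) u) = D1 := by
    ext c
    simp only [Finset.mem_filter, ← mem_dsc, k3]
    constructor
    · rintro ⟨a, b, e⟩
      by_contra hc
      rw [F.e2 c (by simp [a, hc]) b] at e
      exact G.disj _ e (F.m2 c (by simp [a, hc]) b)
    · intro hc
      refine ⟨hD' hc, ?_, ?_⟩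
      · rintro rfl; exact hd1 hc
      · rw [F.e1 c hc]; exact F.m1 c hc
  simp only [unglue]
  rw [eDD, k3]
  have a1 : (fun x => if x ∈ U1 ∧ x ≠ u then p x else none) = p1 := by
    funext x
    split_ifs with h
    · exact G.e1 x h.1 h.2
    · by_cases hxu : x = u
      · rw [hxu, hu0]
      · by_contra hx
        obtain ⟨z, hz⟩ := Option.ne_none_iff_exists'.1 (Ne.symm hx)
        exact h ⟨(G.c1 _ _ hz).1, hxu⟩
  have a2 : (fun c => if c ∈ D1 then f c else v0) = f1 := by
    funext c
    split_ifs with h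
    · exact F.e1 c h
    · exact (h1.f0 c h).symm
  have a3 : (fun x => if x ∈ U1 then none else p x) = p2 := by
    funext x
    split_ifs with h
    · by_contra hx
      obtain ⟨z, hz⟩ := Option.ne_none_iff_exists'.1 (Ne.symm hx)
      exact G.disj _ h (G.c2 _ _ hz).1
    · simp [hp, h]
  have a4 : (fun c => if c = d0 then (p u).getD v0 else if c ∈ D1 then v0 else f c) = f2 := by
    funext c
    split_ifs with h h'
    · rw [G.eu, h]; rfl
    · exact (h2.f0 c (by simp [h'])).symm
    · simp [hf, h, h']
  rw [a1, a2, a3, a4]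
  simp [hf]

open Classical in
lemma unglue_spec {v0 : V} {U : Finset V} {D : Finset C} {d0 : C} (hd : d0 ∈ D)
    {t : (V → Option V) × (C → V)} (h : IsSP v0 U D t) {u : V} (hc : IsCut d0 D t u) :
    unglue v0 D d0 t u ∈ Dec v0 U D d0 ∧ glue d0 (unglue v0 D d0 t u) = t := by
  obtain ⟨p, f⟩ := t
  obtain ⟨w, hw⟩ := Option.ne_none_iff_exists'.1 hc.nr
  simp only at hw
  simp only [unglue]
  set U1 := dsc p u with hU1
  set D1 := D.filter (fun c => c ≠ d0 ∧ R p (f c) u) with hD1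
  set p1 : V → Option V := fun x => if x ∈ U1 ∧ x ≠ u then p x else none with hp1
  set f1 : C → V := fun c => if c ∈ D1 then f c else v0 with hf1
  set p2 : V → Option V := fun x => if x ∈ U1 then none else p x with hp2
  set f2 : C → V := fun c => if c = d0 then (p u).getD v0 else if c ∈ D1 then v0 else f c with hf2
  have hT := h.tree
  have hfD := h.fD
  have hcR := hc.r
  have hone := hc.one
  simp only at hT hfD hcR hone
  have huU : u ∈ U := (hT.cl _ _ hw).1
  have hUU : U1 ⊆ U := fun x hx => hT.mem_of_R (mem_dsc.1 hx) huU
  have hDD : D1 ⊆ D := Finset.filter_subset _ _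
  have hd1 : d0 ∉ D1 := by simp [hD1]
  have eU : U1 ∪ (U \ U1) = U := Finset.union_sdiff_of_subset hUU
  have eD : D1 ∪ (D \ D1) = D := Finset.union_sdiff_of_subset hDD
  have huU1 : u ∈ U1 := mem_dsc.2 (R.refl' _ _)
  have hstep : ∀ x y, x ∈ U1 → x ≠ u → p x = some y → y ∈ U1 := by
    intro x y hx hxu hxy
    rcases (mem_dsc.1 hx).of_some hxy with h | h
    · exact absurd h hxu
    · exact mem_dsc.2 h
  have hstep' : ∀ x y, y ∈ U1 → p x = some y → x ∈ U1 :=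
    fun x y hy hxy => mem_dsc.2 (R.head' hxy (mem_dsc.1 hy))
  have G : Glue U1 (U \ U1) p1 p2 p u w := by
    refine ⟨by intro x hx; simp [hx], huU1, ?_, ?_, hw, by simp [hp1], ?_, ?_, ?_, ?_, ?_⟩
    · rw [Finset.mem_sdiff]
      refine ⟨(hT.cl _ _ hw).2, ?_⟩
      intro hwu
      have hwu' := mem_dsc.1 hwu
      have e := hT.antisymm hwu' (R.head' hw (R.refl' _ _))
      obtain ⟨r, hr, hr0, hrr⟩ := hT.root
      -- p u = some u : contradiction
      subst e
      have hl : ∀ y, R p w y → y = w := by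
        intro y hy
        induction hy with
        | refl => rfl
        | tail _ h2 ih => subst ih; rw [hw] at h2; cases h2; rfl
      have := hl r (hrr w huU)
      subst this
      rw [hr0] at hw; cases hw
    · intro x hx hxu
      simp [hp1, hx, hxu]
    · intro x hx
      have := (Finset.mem_sdiff.1 hx).2
      simp [hp2, this]
    · intro x hx
      obtain ⟨z, hz⟩ := Option.ne_none_iff_exists'.1 hx
      have := (hT.cl _ _ hz).1
      by_cases hx1 : x ∈ U1 <;> simp [hx1, this]
    · intro x y hxy
      simp only [hp1] at hxy
      split_ifs at hxy with h
      exact ⟨h.1, hstep x y h.1 h.2 hxy⟩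
    · intro x y hxy
      simp only [hp2] at hxy
      split_ifs at hxy with h
      have := hT.cl _ _ hxy
      rw [Finset.mem_sdiff, Finset.mem_sdiff]
      exact ⟨⟨this.1, h⟩, this.2, fun h' => h (hstep' x y h' hxy)⟩
    · intro x hx
      have hx' := mem_dsc.1 hx
      clear hx
      induction hx' using ReflTransGen.head_induction_on with
      | refl => exact R.refl' _ _
      | head h hcr ih =>
        rename_i x z
        by_cases hxu : x = u
        · rw [hxu]; exact R.refl' _ _
        · refine R.head' ?_ ih
          have : x ∈ U1 := mem_dsc.2 (R.head' h hcr)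
          simp [hp1, this, hxu, h]
  have eDs : D.filter (fun c => R p (f c) u) = insert d0 D1 := by
    ext c
    simp only [hD1, Finset.mem_filter, Finset.mem_insert]
    by_cases hc0 : c = d0
    · subst hc0; simp [hd, hcR]
    · simp [hc0]
  have hcard : U1.card = D1.card := by
    rw [flux, eDs, Finset.card_insert_of_notMem hd1, ← hU1] at hone
    push_cast at hone
    omega
  have F : GlueF U1 (U \ U1) D1 (D \ D1) f1 f2 f d0 w := by
    refine ⟨by intro x hx; simp [hx], by simp [hd, hd1], mem_dsc.2 hcR, by simp [hf2, hw],
      ?_, ?_, ?_, ?_, hcard⟩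
    · intro c hc; simp [hf1, hc]
    · intro c hc
      simp only [hf1, hc, if_true]
      exact mem_dsc.2 (Finset.mem_filter.1 hc).2.2
    · intro c hc hc0
      have := (Finset.mem_sdiff.1 hc).2
      simp [hf2, this, hc0]
    · intro c hc hc0
      have := (Finset.mem_sdiff.1 hc)
      simp only [hf2, this.2, hc0, if_false]
      rw [Finset.mem_sdiff]
      refine ⟨hfD c this.1, fun h => this.2 ?_⟩
      exact Finset.mem_filter.2 ⟨this.1, hc0, mem_dsc.1 h⟩
  have key := unglue_SP v0 G F (by intro c hc; simp [hf1, hc]) (by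
    intro c hc
    have hc0 : c ≠ d0 := by rintro rfl; exact hc F.h0
    by_cases hc1 : c ∈ D1
    · simp [hf2, hc0, hc1]
    · simp only [hf2, hc0, hc1, if_false]
      exact h.f0 c (fun h => hc (by simp [h, hc1]))) (by rwa [eU, eD]) (by rwa [eD])
  constructor
  · simp only [Dec, Idx, Finset.mem_sigma, Finset.mem_filter, Finset.mem_product,
      Finset.mem_powerset, mem_TT]
    refine ⟨⟨⟨hUU, ?_⟩, hcard⟩, key.1, F.f0, key.2⟩
    intro c hc
    rw [Finset.mem_erase]
    exact ⟨by rintro rfl; exact hd1 hc, hDD hc⟩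
  · simp only [glue]
    ext1
    · funext x
      simp only
      split_ifs with hx
      · by_cases hxu : x = u
        · rw [hxu, G.e1u, G.eu, F.f20]; rfl
        · have hxr : p1 x = p x := (G.e1 x hx hxu).symm
          rw [hxr]
          have : p x ≠ none := fun h0 => hxu ((mem_dsc.1 hx).of_none h0)
          obtain ⟨z, hz⟩ := Option.ne_none_iff_exists'.1 this
          rw [hz]; rfl
      · simp [hp2, hx]
    · funext c
      simp only
      split_ifs with hc0 hc1
      · rw [hc0]
      · exact (F.e1 c hc1).symm
      · simp [hf2, hc0, hc1]

open Classical in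
lemma card_rec (v0 : V) (U : Finset V) (D : Finset C) (hc : U.card = D.card) (h2 : 2 ≤ U.card)
    {d0 : C} (hd : d0 ∈ D) : (TT v0 U D).card = ∑ i ∈ Idx U D d0,
      (TT v0 i.1 i.2).card * (i.1.card * (TT v0 (U \ i.1) (D \ i.2)).card) := by
  have : (Dec v0 U D d0).card = (TT v0 U D).card := by
    refine Finset.card_bij (fun x _ => glue d0 x) (fun x hx => (glue_spec hd hx).1) ?_ ?_
    · intro x hx y hy hxy
      obtain ⟨u, hu, eu⟩ := (glue_spec hd hx).2
      obtain ⟨u', hu', eu'⟩ := (glue_spec hd hy).2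
      rw [← hxy] at hu' eu'
      rw [← eu, ← eu', hu.unique hu']
    · intro t ht
      obtain ⟨u, hu⟩ := exists_cut (mem_TT.1 ht) hc h2 hd
      have := unglue_spec hd (mem_TT.1 ht) hu
      exact ⟨_, this.1, this.2⟩
  rw [← this, Dec, Finset.card_sigma]
  simp [Finset.card_product]

lemma TT_empty (v0 : V) (D : Finset C) : TT v0 (∅ : Finset V) D = ∅ := by
  rw [Finset.eq_empty_iff_forall_notMem]
  intro t ht
  obtain ⟨r, hr, _⟩ := (mem_TT.1 ht).tree.root
  simp at hr

open Classical in
lemma TT_one (v0 : V) (a : V) (d : C) : (TT v0 {a} {d}).card = 1 := by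
  rw [Finset.card_eq_one]
  refine ⟨(fun _ => none, fun c => if c = d then a else v0), ?_⟩
  ext ⟨p, f⟩
  rw [mem_TT, Finset.mem_singleton]
  constructor
  · intro h
    obtain ⟨r, hr, hr0, _⟩ := h.tree.root
    rw [Finset.mem_singleton] at hr
    subst hr
    ext1
    · funext x
      by_contra hx
      obtain ⟨z, hz⟩ := Option.ne_none_iff_exists'.1 hx
      have := (h.tree.cl _ _ hz).1
      rw [Finset.mem_singleton] at this
      subst this
      exact hx hr0
    · funext c
      simp only
      split_ifs with hc
      · simpa using h.fD c (by simp [hc])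
      · exact h.f0 c (by simp [hc])
  · intro h
    cases h
    refine ⟨⟨by simp, a, by simp, rfl, ?_⟩, by simp, ?_, by simp⟩
    · intro x hx
      rw [Finset.mem_singleton.1 hx]; exact R.refl' _ _
    · intro c hc
      simp only [Finset.mem_singleton] at hc
      simp [hc]

lemma fact_cat (a : ℕ) : (2 * a).factorial = catalan a * (a.factorial * (a + 1).factorial) := by
  have h1 := succ_mul_catalan_eq_centralBinom a
  have h2 := Nat.centralBinom_eq_two_mul_choose a
  have h3 := Nat.choose_mul_factorial_mul_factorial (show a ≤ 2 * a by omega)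
  rw [show 2 * a - a = a by omega, ← h2, ← h1] at h3
  rw [← h3, Nat.factorial_succ]
  ring

lemma num_term (a b : ℕ) : (a + b + 2).choose (a + 1) * ((a + b + 1).choose (a + 1) *
    ((2 * a).factorial * ((a + 1) * (2 * b).factorial))) =
    (a + b + 2).factorial * (a + b + 1).factorial * (catalan a * catalan b) := by
  have h1 := Nat.choose_mul_factorial_mul_factorial (show a + 1 ≤ a + b + 2 by omega)
  have h2 := Nat.choose_mul_factorial_mul_factorial (show a + 1 ≤ a + b + 1 by omega)
  rw [show a + b + 2 - (a + 1) = b + 1 by omega] at h1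
  rw [show a + b + 1 - (a + 1) = b by omega] at h2
  rw [← h1, ← h2, fact_cat, fact_cat b, Nat.factorial_succ a]
  ring

lemma num_sum (k : ℕ) : ∑ ij ∈ Finset.HasAntidiagonal.antidiagonal k, (k + 2).choose (ij.1 + 1) *
    ((k + 1).choose (ij.1 + 1) *
    ((2 * ij.1).factorial * ((ij.1 + 1) * (2 * ij.2).factorial))) = (2 * (k + 1)).factorial := by
  have : ∀ ij ∈ Finset.HasAntidiagonal.antidiagonal k, (k + 2).choose (ij.1 + 1) * ((k + 1).choose (ij.1 + 1) *
    ((2 * ij.1).factorial * ((ij.1 + 1) * (2 * ij.2).factorial))) =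
    (k + 2).factorial * (k + 1).factorial * (catalan ij.1 * catalan ij.2) := by
    rintro ⟨a, b⟩ h
    rw [Finset.HasAntidiagonal.mem_antidiagonal] at h
    subst h
    exact num_term a b
  rw [Finset.sum_congr rfl this, ← Finset.mul_sum, ← catalan_succ', fact_cat]
  ring

open Classical in
lemma card_TT (v0 : V) : ∀ (m : ℕ) (U : Finset V) (D : Finset C), U.card = m + 1 → D.card = m + 1 →
    (TT v0 U D).card = (2 * m).factorial := by
  intro m
  induction m using Nat.strong_induction_on with
  | _ m ih =>
  intro U D hU hD
  rcases m with _ | k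
  · obtain ⟨a, rfl⟩ := Finset.card_eq_one.1 hU
    obtain ⟨d, rfl⟩ := Finset.card_eq_one.1 hD
    rw [TT_one]; rfl
  obtain ⟨d0, hd⟩ : D.Nonempty := Finset.card_pos.1 (by omega)
  rw [card_rec v0 U D (by omega) (by omega) hd, ← num_sum]
  have hDe : (D.erase d0).card = k + 1 := by rw [Finset.card_erase_of_mem hd]; omega
  set g : Finset V × Finset C → ℕ := fun i => 
      (TT v0 i.1 i.2).card * (i.1.card * (TT v0 (U \ i.1) (D \ i.2)).card) with hg
  set I : ℕ → Finset (Finset V × Finset C) := fun i =>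
    U.powersetCard (i + 1) ×ˢ (D.erase d0).powersetCard (i + 1) with hI
  have hsub : (Finset.HasAntidiagonal.antidiagonal k).biUnion (fun ij => I ij.1) ⊆ Idx U D d0 := by
    rintro ⟨U1, D1⟩ h
    simp only [hI, Finset.mem_biUnion, Finset.mem_product, Finset.mem_powersetCard] at h
    simp only [Idx, Finset.mem_filter, Finset.mem_product, Finset.mem_powerset]
    obtain ⟨ij, _, h1, h2⟩ := h
    exact ⟨⟨h1.1, h2.1⟩, by omega⟩
  rw [← Finset.sum_subset hsub, Finset.sum_biUnion]
  · apply Finset.sum_congr rfl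
    rintro ⟨a, b⟩ hab
    rw [Finset.HasAntidiagonal.mem_antidiagonal] at hab
    simp only at hab ⊢
    rw [Finset.sum_congr rfl (g := fun _ =>
      (2 * a).factorial * ((a + 1) * (2 * b).factorial))]
    · rw [Finset.sum_const, hI, Finset.card_product, Finset.card_powersetCard,
        Finset.card_powersetCard, hU, hDe, smul_eq_mul, mul_assoc]
    · rintro ⟨U1, D1⟩ h
      simp only [hI, Finset.mem_product, Finset.mem_powersetCard] at h
      obtain ⟨⟨hs1, hc1⟩, hs2, hc2⟩ := h
      have hs2' : D1 ⊆ D := hs2.trans (Finset.erase_subset _ _)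
      simp only [hg]
      rw [ih a (by omega) U1 D1 hc1 hc2, ih b (by omega), hc1]
      · rw [Finset.card_sdiff_of_subset hs1]; omega
      · rw [Finset.card_sdiff_of_subset hs2']; omega
  · rintro ⟨a, b⟩ hab ⟨a', b'⟩ hab' hne
    simp only [Function.onFun, Finset.mem_coe, Finset.HasAntidiagonal.mem_antidiagonal] at *
    rw [Finset.disjoint_left]
    rintro ⟨U1, D1⟩ h h'
    simp only [hI, Finset.mem_product, Finset.mem_powersetCard] at h h'
    apply hne
    ext1 <;> simp only <;> omega
  · rintro ⟨U1, D1⟩ h1 h2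
    simp only [Idx, Finset.mem_filter, Finset.mem_product, Finset.mem_powerset] at h1
    obtain ⟨⟨hs1, hs2⟩, hc⟩ := h1
    simp only [hg]
    rcases U1.eq_empty_or_nonempty with rfl | hne
    · simp
    · exfalso
      have h3 := Finset.card_le_card hs2
      have h4 := Finset.card_pos.2 hne
      apply h2
      rw [Finset.mem_biUnion]
      refine ⟨(U1.card - 1, k - (U1.card - 1)), ?_, ?_⟩
      · rw [Finset.HasAntidiagonal.mem_antidiagonal]; simp only; omega
      · simp only [hI, Finset.mem_product, Finset.mem_powersetCard]
        refine ⟨⟨hs1, by omega⟩, hs2, by omega⟩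

end SPk

namespace SPk
open Relation

variable {n : ℕ} {p : Fin n → Option (Fin n)}

lemma dsc_lt (hT : IsT Finset.univ p) {v w : Fin n} (h : p v = some w) :
    (dsc p v).card < (dsc p w).card := by
  have hvw : R p v w := R.head' h (R.refl' _ _)
  apply Finset.card_lt_card
  rw [Finset.ssubset_iff_of_subset (by intro x hx; rw [mem_dsc] at *; exact hx.tr hvw)]
  refine ⟨w, mem_dsc.2 (R.refl' _ _), ?_⟩
  intro hw
  have e := hT.antisymm hvw (mem_dsc.1 hw)
  subst e
  obtain ⟨r, hr, hr0, hrr⟩ := hT.root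
  have hl : ∀ y, R p v y → y = v := by
    intro y hy
    induction hy with
    | refl => rfl
    | tail _ h2 ih => subst ih; rw [h] at h2; cases h2; rfl
  have := hl r (hrr v (Finset.mem_univ _))
  subst this
  rw [hr0] at h; cases h

lemma drive_spec (hT : IsT Finset.univ p) (occ : Finset (Fin n)) : ∀ (k : ℕ) (v : Fin n),
    n < k + (dsc p v).card →
    (driveFlux p occ k v = none ∧ ∃ r ∈ occ, p r = none) ∨
    (∃ s P, driveFlux p occ k v = some (s, P) ∧ s ∉ occ ∧ R p v s ∧ P ⊆ occ ∧
      ∀ x, x ∈ P ↔ (R p v x ∧ R p x s ∧ x ≠ s)) := by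
  intro k
  induction k with
  | zero =>
    intro v hv
    have := Finset.card_le_univ (dsc p v)
    rw [Fintype.card_fin] at this
    omega
  | succ k ih =>
    intro v hv
    rw [driveFlux]
    by_cases hocc : v ∈ occ
    · rw [if_pos hocc]
      rcases hpv : p v with _ | w
      · left
        exact ⟨rfl, v, hocc, hpv⟩
      · have := dsc_lt hT hpv
        rcases ih w (by omega) with ⟨h1, h2⟩ | ⟨s, P, h1, h2, h3, h4, h5⟩
        · left
          exact ⟨by simp [h1], h2⟩
        · right
          have hvs : R p v s := R.head' hpv h3
          refine ⟨s, insert v P, by simp [h1], h2, hvs, Finset.insert_subset hocc h4, ?_⟩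
          intro x
          rw [Finset.mem_insert, h5]
          constructor
          · rintro (rfl | ⟨a, b, c⟩)
            · exact ⟨R.refl' _ _, hvs, by rintro rfl; exact h2 hocc⟩
            · exact ⟨R.head' hpv a, b, c⟩
          · rintro ⟨a, b, c⟩
            rcases a.of_some hpv with h | h
            · exact Or.inl h.symm
            · exact Or.inr ⟨h, b, c⟩
    · rw [if_neg hocc]
      right
      refine ⟨v, ∅, rfl, hocc, R.refl' _ _, by simp, ?_⟩
      intro x
      simp only [Finset.notMem_empty, false_iff]
      rintro ⟨a, b, c⟩
      exact c (hT.antisymm b a)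

lemma card_dsc_pos (v : Fin n) : 0 < (dsc p v).card := Finset.card_pos.2 ⟨v, mem_dsc.2 (R.refl' _ _)⟩

/-- remaining weight -/
noncomputable def wt (L : List (Fin n)) (occ : Finset (Fin n)) (x : Fin n) : ℤ :=
  (L.count x : ℤ) - if x ∈ occ then 0 else 1

lemma wt_nonneg (L : List (Fin n)) {occ : Finset (Fin n)} {x : Fin n} (h : x ∈ occ) :
    0 ≤ wt L occ x := by simp [wt, h]

lemma wt_univ (L : List (Fin n)) (occ : Finset (Fin n)) :
    ∑ x, wt L occ x = (L.length : ℤ) - (occᶜ).card := by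
  classical
  simp only [wt, Finset.sum_sub_distrib]
  congr 1
  · have := Multiset.toFinset_sum_count_eq (L : Multiset (Fin n))
    rw [← Nat.cast_sum]
    congr 1
    rw [← Multiset.coe_card, ← this]
    symm
    apply Finset.sum_subset_zero_on_sdiff (Finset.subset_univ _)
    · intro x hx
      simp at hx
      simpa [List.count_eq_zero] using hx
    · intro x _; simp
  · have : ∀ x : Fin n, (if x ∈ occ then (0:ℤ) else 1) = if x ∈ occᶜ then 1 else 0 := by
      intro x; by_cases h : x ∈ occ <;> simp [h]
    rw [Finset.sum_congr rfl (fun x _ => this x), Finset.sum_ite_mem, Finset.univ_inter,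
      Finset.sum_const, nsmul_eq_mul, mul_one]

lemma wt_cons (a : Fin n) (L : List (Fin n)) (occ : Finset (Fin n)) {s : Fin n} (hs : s ∉ occ)
    (x : Fin n) : wt (a :: L) occ x = wt L (insert s occ) x + ((if x = a then 1 else 0) -
      if x = s then 1 else 0) := by
  classical
  simp only [wt, List.count_cons, Finset.mem_insert]
  have e : (a == x) = decide (x = a) := by
    by_cases h : x = a
    · simp [h]
    · simp [h, Ne.symm h]
  rw [e]
  by_cases h1 : x = a <;> by_cases h2 : x = s <;> by_cases h3 : x ∈ occ <;>
    simp_all <;> ring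

open Classical in
lemma wt_cons_sum (a : Fin n) (L : List (Fin n)) (occ : Finset (Fin n)) {s : Fin n} (hs : s ∉ occ)
    (v : Fin n) : ∑ x ∈ dsc p v, wt (a :: L) occ x = ∑ x ∈ dsc p v, wt L (insert s occ) x +
      ((if R p a v then 1 else 0) - if R p s v then 1 else 0) := by
  rw [Finset.sum_congr rfl (fun x _ => wt_cons a L occ hs x), Finset.sum_add_distrib,
    Finset.sum_sub_distrib]
  simp [mem_dsc]

open Classical in
lemma park_iff (hT : IsT Finset.univ p) : ∀ (L : List (Fin n)) (occ used : Finset (Fin n)),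
    used ⊆ occ → L.length = (occᶜ).card →
    ((∃ occ' used', parkFlux p occ used L = some (occ', used') ∧ ∀ v, (p v).isSome → v ∈ used') ↔
      ∀ v, p v ≠ none → v ∉ used → 1 ≤ ∑ x ∈ dsc p v, wt L occ x) := by
  intro L
  induction L with
  | nil =>
    intro occ used _ hlen
    have hocc : occ = Finset.univ := by
      rw [← Finset.compl_eq_empty_iff, ← Finset.card_eq_zero, ← hlen]; rfl
    subst hocc
    constructor
    · rintro ⟨occ', used', h, h'⟩ v hv hv'
      simp only [parkFlux, Option.some.injEq, Prod.mk.injEq] at h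
      rw [← h.2] at h'
      exact absurd (h' v (Option.isSome_iff_ne_none.2 hv)) hv'
    · intro h
      refine ⟨_, _, rfl, ?_⟩
      intro v hv
      by_contra hv'
      have := h v (Option.isSome_iff_ne_none.1 hv) hv'
      simp [wt] at this
  | cons a L ih =>
    intro occ used hsub hlen
    -- lower bounds on sums over sets containing all the empty spots
    have low : ∀ (L : List (Fin n)) (occ : Finset (Fin n)) (W M : Finset (Fin n)), M ⊆ W →
        (∀ x y, y ∈ W → R p x y → x ∈ W) → (∀ x ∈ W, x ∉ M → x ∈ occ) →
        (∀ w ∈ M, 1 ≤ ∑ x ∈ dsc p w, wt L occ x) →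
        0 ≤ ∑ x ∈ W, wt L occ x ∧ (M.Nonempty → 1 ≤ ∑ x ∈ W, wt L occ x) := by
      intro L occ W M hMW hcl hocc h1
      have hu := union_dsc p (wt L occ) M.card M le_rfl h1
      have hs : M.biUnion (dsc p) ⊆ W := by
        intro x hx
        simp only [Finset.mem_biUnion, mem_dsc] at hx
        obtain ⟨y, hy, hxy⟩ := hx
        exact hcl x y (hMW hy) hxy
      have h2 := Finset.sum_sdiff (f := wt L occ) hs
      have h3 : 0 ≤ ∑ x ∈ W \ M.biUnion (dsc p), wt L occ x := by
        apply Finset.sum_nonneg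
        intro x hx
        rw [Finset.mem_sdiff] at hx
        apply wt_nonneg
        apply hocc x hx.1
        intro hxM
        exact hx.2 (Finset.mem_biUnion.2 ⟨x, hxM, mem_dsc.2 (R.refl' _ _)⟩)
      refine ⟨by linarith [hu.1], fun hne => by linarith [hu.2 hne]⟩
    obtain ⟨r, _, hr0, hrr⟩ := hT.root
    have hnr : ∀ x, x ≠ r → p x ≠ none := fun x hxr h0 =>
      hxr ((hrr x (Finset.mem_univ _)).of_none h0)
    rcases drive_spec hT occ n a (by have := card_dsc_pos (p := p) a; omega) with
      ⟨h1, r', hr', hr'0⟩ | ⟨s, P, h1, h2, h3, h4, h5⟩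
    · have hrr' : r' = r := by by_contra hne; exact hnr r' hne hr'0
      subst hrr'
      constructor
      · rintro ⟨occ', used', h, _⟩
        rw [parkFlux, h1] at h
        cases h
      · intro h
        exfalso
        have := (low (a :: L) occ Finset.univ occᶜ (Finset.subset_univ _) (by simp) (by
          intro x _ hx; simpa using hx) (by
          intro w hw
          rw [Finset.mem_compl] at hw
          apply h w (hnr w (by rintro rfl; exact hw hr'))
          exact fun hh => hw (hsub hh))).2 (by
          rw [← Finset.card_pos, ← hlen]; simp)
        rw [wt_univ, hlen] at this
        omega
    · have hpk : parkFlux p occ used (a :: L) = parkFlux p (insert s occ) (used ∪ P) L := by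
        rw [parkFlux, h1]
      have hlen' : L.length = ((insert s occ)ᶜ).card := by
        rw [Finset.card_compl, Finset.card_insert_of_notMem h2]
        rw [Finset.card_compl, List.length_cons] at hlen
        omega
      have hsub' : used ∪ P ⊆ insert s occ :=
        (Finset.union_subset hsub h4).trans (Finset.subset_insert _ _)
      rw [hpk, ih _ _ hsub' hlen']
      have heq : ∀ v, v ∉ P → ∑ x ∈ dsc p v, wt (a :: L) occ x =
          ∑ x ∈ dsc p v, wt L (insert s occ) x := by
        intro v hv
        rw [wt_cons_sum a L occ h2]
        have : R p a v ↔ R p s v := by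
          constructor
          · intro h
            rcases h.total h3 with h' | h'
            · by_cases hvs : v = s
              · rw [hvs]; exact R.refl' _ _
              · exact absurd ((h5 v).2 ⟨h, h', hvs⟩) hv
            · exact h'
          · exact fun h => h3.tr h
        simp [this]
      constructor
      · intro h v hv hvu
        by_cases hvP : v ∈ P
        · obtain ⟨q1, q2, q3⟩ := (h5 v).1 hvP
          have hsv : ¬ R p s v := fun hh => q3 (hT.antisymm q2 hh)
          rw [wt_cons_sum a L occ h2, if_pos q1, if_neg hsv]
          have := (low L (insert s occ) (dsc p v) ((dsc p v).filter (fun x => x ∉ insert s occ))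
            (Finset.filter_subset _ _) (by
              intro x y hy hxy; rw [mem_dsc] at *; exact hxy.tr hy) (by
              intro x hx hx'
              by_contra hh
              exact hx' (Finset.mem_filter.2 ⟨hx, hh⟩)) (by
              intro w hw
              rw [Finset.mem_filter, mem_dsc] at hw
              apply h w
              · intro h0
                have := hw.1.of_none h0
                subst this
                exact hw.2 (Finset.mem_insert_of_mem (h4 hvP))
              · exact fun hh => hw.2 (hsub' hh))).1
          omega
        · rw [heq v hvP]
          exact h v hv (by simp [hvu, hvP])
      · intro h v hv hvu
        rw [Finset.mem_union, not_or] at hvu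
        rw [← heq v hvu.2]
        exact h v hv hvu.1

lemma pstep_none (k : ℕ) : (pstep p)^[k] none = none := by
  induction k with
  | zero => rfl
  | succ k ih => rw [Function.iterate_succ_apply]; exact ih

lemma tree_iff : IsRootedTree p ↔ IsT Finset.univ p := by
  constructor
  · rintro ⟨hf, r, hr, huniq⟩
    refine ⟨by simp, r, Finset.mem_univ _, hr, ?_⟩
    intro x _
    have : ∀ k x, (pstep p)^[k] (some x) = none → R p x r := by
      intro k
      induction k with
      | zero => intro x h; cases h
      | succ k ih =>
        intro x h
        rw [Function.iterate_succ_apply] at h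
        rcases hpx : p x with _ | y
        · rw [huniq x hpx]; exact R.refl' _ _
        · have : pstep p (some x) = some y := by simp [pstep, hpx]
          rw [this] at h
          exact R.head' hpx (ih y h)
    exact this n x (hf x)
  · intro hT
    obtain ⟨r, _, hr0, hrr⟩ := hT.root
    refine ⟨?_, r, hr0, ?_⟩
    · have : ∀ k x, n < k + (dsc p x).card → (pstep p)^[k] (some x) = none := by
        intro k
        induction k with
        | zero =>
          intro x h
          have := Finset.card_le_univ (dsc p x)
          rw [Fintype.card_fin] at this
          omega
        | succ k ih =>
          intro x h
          rw [Function.iterate_succ_apply]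
          rcases hpx : p x with _ | y
          · have : pstep p (some x) = none := by simp [pstep, hpx]
            rw [this]; exact pstep_none k
          · have : pstep p (some x) = some y := by simp [pstep, hpx]
            rw [this]
            apply ih
            have := dsc_lt hT hpx
            omega
      intro x
      exact this n x (by have := card_dsc_pos (p := p) x; omega)
    · intro y hy
      exact (hrr y (Finset.mem_univ _)).of_none hy

open Classical in
lemma count_ofFn (f : Fin n → Fin n) (x : Fin n) :
    (List.ofFn f).count x = (Finset.univ.filter (fun c => f c = x)).card := by
  rw [List.ofFn_eq_map, List.count, List.countP_map, List.countP_eq_length_filter,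
    Finset.card_def, Finset.filter_val]
  have : (Finset.univ : Finset (Fin n)).val = (List.finRange n : Multiset (Fin n)) := rfl
  rw [this, Multiset.filter_coe, Multiset.coe_card]
  congr 2

lemma final_iff (v0 : Fin n) (q : (Fin n → Option (Fin n)) × (Fin n → Fin n)) :
    (IsRootedTree q.1 ∧ ∃ occ used : Finset (Fin n),
      parkFlux q.1 ∅ ∅ (List.ofFn q.2) = some (occ, used) ∧
      ∀ v, (q.1 v).isSome → v ∈ used) ↔ IsSP v0 Finset.univ Finset.univ q := by
  classical
  have hfl : ∀ v, ∑ x ∈ dsc q.1 v, wt (List.ofFn q.2) ∅ x = flux q.1 q.2 Finset.univ v := by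
    intro v
    rw [flux_eq]
    apply Finset.sum_congr rfl
    intro x _
    simp [wt, count_ofFn]
    congr
  rw [tree_iff]
  constructor
  · rintro ⟨hT, h⟩
    refine ⟨hT, by simp, by simp, ?_⟩
    intro v hv
    rw [← hfl]
    exact (park_iff hT _ ∅ ∅ (by simp) (by simp)).1 h v hv (by simp)
  · intro h
    refine ⟨h.tree, (park_iff h.tree _ ∅ ∅ (by simp) (by simp)).2 ?_⟩
    intro v hv _
    rw [hfl]
    exact h.fl v hv

end SPk

/-- The number of strongly parked trees with `n` vertices and `n` cars is `(2n-2)!`. -/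
theorem stmt15 (n : ℕ) (hn : 1 ≤ n) : SP n n = Nat.factorial (2 * n - 2) := by
  classical
  have h := SPk.card_TT (C := Fin n) (⟨0, hn⟩ : Fin n) (n - 1) Finset.univ Finset.univ
    (by rw [Finset.card_univ, Fintype.card_fin]; omega)
    (by rw [Finset.card_univ, Fintype.card_fin]; omega)
  rw [show 2 * n - 2 = 2 * (n - 1) by omega, ← h, SP]
  rw [Nat.card_congr (Equiv.subtypeEquivRight (fun q => SPk.final_iff (⟨0, hn⟩ : Fin n) q)),
    Nat.card_eq_fintype_card, Fintype.card_subtype, SPk.TT]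
  congr <;> exact Subsingleton.elim _ _
end
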